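/- arXiv:q-alg/9707028 — 2 statements merged into one kernel-verified Lean document; each statement's English description precedes it below -/
import Mathlib

section
/- Vanishing Theorem, part 2: Let n ≥ 1 and let λ be a partition with at most n parts. Then s_λ(a_λ|a) = ∏_{(i,j)∈λ} (a_{λ_i+n−i+1} − a_{n−λ^t_j+j}), as an identity in ℤ[a_i : i ∈ ℤ], where λ^t is the conjugate (transposed) partition of λ. -/
open scoped BigOperators

namespace FactorialLR

/-- A filling of the cell set `s` with entries in `Fin n` (`0`-based, representing the
`1`-based entries `{1,…,n}`) is semistandard if it weakly increases along rows and strictly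
increases down columns. -/
def IsSsyt {n : ℕ} (s : Finset (ℕ × ℕ)) (T : s → Fin n) : Prop :=
  (∀ c c' : s, (c : ℕ × ℕ).1 = (c' : ℕ × ℕ).1 → (c : ℕ × ℕ).2 ≤ (c' : ℕ × ℕ).2 → T c ≤ T c') ∧
  (∀ c c' : s, (c : ℕ × ℕ).1 < (c' : ℕ × ℕ).1 → (c : ℕ × ℕ).2 = (c' : ℕ × ℕ).2 → T c < T c')

/-- The factorial Schur-type polynomial attached to a (possibly skew) cell set `s`:
`Σ_T ∏_{α ∈ s} (x_{T(α)} − a_{T(α)+c(α)})`, where `T` runs over semistandard fillings of `s`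
with entries in `{1,…,n}` (stored `0`-based) and `c(α) = j − i` is the content of `α = (i,j)`.
Taking `a = 0` gives the ordinary Schur polynomial. -/
noncomputable def sgen {A : Type} [CommRing A] (n : ℕ) (s : Finset (ℕ × ℕ))
    (x : Fin n → A) (a : ℤ → A) : A :=
  ∑ᶠ T ∈ {T : s → Fin n | IsSsyt s T},
    ∏ c : s, (x (T c) - a ((T c : ℤ) + 1 + ((c : ℕ × ℕ).2 : ℤ) - ((c : ℕ × ℕ).1 : ℤ)))

/-- The `n`-tuple `a_ρ = (a_{ρ_1+n}, a_{ρ_2+n-1}, …, a_{ρ_n+1})`; the `i`-th entry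
(`0`-based `i`) is `a_{ρ_{i+1}+n-(i+1)+1}`. -/
noncomputable def subA {A : Type} [CommRing A] (n : ℕ) (a : ℤ → A) (ρ : YoungDiagram) :
    Fin n → A :=
  fun i => a ((ρ.rowLen i : ℤ) + (n : ℤ) - (i : ℤ))

open Finset in
/-- Two-variable factorial complete homogeneous polynomials: telescoping. -/
lemma hsum_tele {A : Type} [CommRing A] (b : ℕ → A) (x y : A) (l r : ℕ) (h : l ≤ r) :
    (x - y) * ∑ p ∈ Icc l r, (∏ j ∈ Ico l p, (x - b j)) * ∏ j ∈ Ico p r, (y - b (j+1)) =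
     ∏ j ∈ Ico l (r+1), (x - b j) - ∏ j ∈ Ico l (r+1), (y - b j) := by
  induction r, h using Nat.le_induction with
  | base => simp
  | succ m h ih =>
    rw [← Finset.insert_Icc_right_eq_Icc_add_one (by omega), sum_insert (by simp),
      prod_Ico_succ_top (b := m+1) (by omega), prod_Ico_succ_top (b := m+1) (by omega)]
    have : ∑ p ∈ Icc l m, (∏ j ∈ Ico l p, (x - b j)) * ∏ j ∈ Ico p (m+1), (y - b (j+1)) =
      (∑ p ∈ Icc l m, (∏ j ∈ Ico l p, (x - b j)) * ∏ j ∈ Ico p m, (y - b (j+1)))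
        * (y - b (m+1)) := by
      rw [sum_mul]
      refine sum_congr rfl fun p hp => ?_
      rw [prod_Ico_succ_top (by simp at hp; omega), mul_assoc]
    rw [this, mul_add, ← mul_assoc (x - y) (Finset.sum _ _), ih]
    simp only [Ico_self, prod_empty]
    ring

open Finset in
lemma hsum_symm {A : Type} [CommRing A] [IsDomain A] (b : ℕ → A) (x y : A) (l r : ℕ) :
    ∑ p ∈ Icc l r, (∏ j ∈ Ico l p, (x - b j)) * ∏ j ∈ Ico p r, (y - b (j+1)) =
    ∑ p ∈ Icc l r, (∏ j ∈ Ico l p, (y - b j)) * ∏ j ∈ Ico p r, (x - b (j+1)) := by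
  by_cases h : l ≤ r
  · by_cases hxy : x = y
    · rw [hxy]
    · apply mul_left_cancel₀ (sub_ne_zero.mpr hxy)
      rw [hsum_tele b x y l r h, ← neg_sub y x, neg_mul, hsum_tele b y x l r h]
      ring
  · rw [Icc_eq_empty h]; simp

/-- upper bound of the `i`-th cut -/
def cutR (ν L : ℕ → ℕ) : ℕ → ℕ
  | 0 => L 0
  | (i+1) => min (L (i+1)) (ν i)

/-- lower bound of the `i`-th cut -/
def cutL (ν L : ℕ → ℕ) (i : ℕ) : ℕ := max (ν i) (L (i+1))

open Finset in
/-- The product over rows of the sum over cuts is symmetric. -/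
lemma rows_symm {A : Type} [CommRing A] [IsDomain A] (n : ℕ) (ν L : ℕ → ℕ)
    (hL : ∀ i, n ≤ i → L i = 0) (a : ℤ → A) (k : ℤ) (x y : A) :
    ∏ i ∈ range n, ∑ p ∈ Icc (cutL ν L i) (cutR ν L i),
      (∏ j ∈ Ico (ν i) p, (x - a (k + 1 + j - i))) * ∏ j ∈ Ico p (L i), (y - a (k + 2 + j - i)) =
    ∏ i ∈ range n, ∑ p ∈ Icc (cutL ν L i) (cutR ν L i),
      (∏ j ∈ Ico (ν i) p, (y - a (k + 1 + j - i))) * ∏ j ∈ Ico p (L i), (x - a (k + 2 + j - i)) := by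
  have key : ∀ x y : A, ∏ i ∈ range n, ∑ p ∈ Icc (cutL ν L i) (cutR ν L i),
      (∏ j ∈ Ico (ν i) p, (x - a (k + 1 + j - i))) * ∏ j ∈ Ico p (L i), (y - a (k + 2 + j - i)) =
      ((∏ i ∈ range n, ∏ j ∈ Ico (ν i) (cutL ν L i), (x - a (k + 1 + j - i))) *
       (∏ i ∈ range n, ∏ j ∈ Ico (cutR ν L i) (L i), (y - a (k + 2 + j - i)))) *
      ∏ i ∈ range n, ∑ p ∈ Icc (cutL ν L i) (cutR ν L i),
        (∏ j ∈ Ico (cutL ν L i) p, (x - a (k + 1 + j - i))) *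
        ∏ j ∈ Ico p (cutR ν L i), (y - a (k + 1 + (j + 1 : ℕ) - i)) := by
    intro x y
    rw [← prod_mul_distrib, ← prod_mul_distrib]
    refine prod_congr rfl fun i hi => ?_
    rw [mul_sum]
    refine sum_congr rfl fun p hp => ?_
    rw [mem_Icc] at hp
    have h1 : ν i ≤ cutL ν L i := le_max_left _ _
    have h2 : cutR ν L i ≤ L i := by
      cases i with
      | zero => simp [cutR]
      | succ i => simp [cutR]
    rw [← prod_Ico_consecutive _ h1 hp.1, ← prod_Ico_consecutive _ hp.2 h2]
    have : ∀ j : ℕ, (k + 1 + (j + 1 : ℕ) - i : ℤ) = k + 2 + j - i := by intro j; push_cast; ring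
    simp only [this]
    ring
  have pair : ∀ x y : A,
      ((∏ i ∈ range n, ∏ j ∈ Ico (ν i) (cutL ν L i), (x - a (k + 1 + j - i))) *
       (∏ i ∈ range n, ∏ j ∈ Ico (cutR ν L i) (L i), (y - a (k + 2 + j - i)))) =
      (∏ i ∈ range (n-1), ∏ j ∈ Ico (ν i) (cutL ν L i), (x - a (k + 1 + j - i))) *
       (∏ i ∈ range (n-1), ∏ j ∈ Ico (ν i) (cutL ν L i), (y - a (k + 1 + j - i))) := by
    intro x y
    cases n with
    | zero => simp
    | succ m =>
      rw [prod_range_succ, prod_range_succ']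
      have e1 : cutL ν L m = ν m := by simp [cutL, hL]
      rw [e1]
      simp only [Ico_self, prod_empty, mul_one, cutR, Nat.add_sub_cancel]
      congr 1
      refine prod_congr rfl fun i hi => ?_
      by_cases h : L (i+1) ≤ ν i
      · simp [cutL, h]
      · push Not at h
        simp only [cutL, min_eq_right h.le, max_eq_right h.le]
        refine prod_congr rfl fun j hj => ?_
        congr 2
        push_cast; ring
  rw [key, key y x, pair, pair, mul_comm (Finset.prod _ _) (Finset.prod _ _)]
  congr 1
  refine prod_congr rfl fun i hi => ?_
  exact hsum_symm (fun j => a (k + 1 + j - i)) x y _ _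

/-- Extension of a tableau by `n` outside of the diagram. -/
def ext {n : ℕ} (lam : YoungDiagram) (T : lam.cells → Fin n) (i j : ℕ) : ℕ :=
  if h : (i, j) ∈ lam.cells then (T ⟨(i, j), h⟩ : ℕ) else n

lemma ext_cell {n : ℕ} (lam : YoungDiagram) (T : lam.cells → Fin n) (c : lam.cells) :
    ext lam T c.1.1 c.1.2 = (T c : ℕ) := by
  have : (c.1.1, c.1.2) ∈ lam.cells := c.2
  simp [ext]

lemma ext_lt {n : ℕ} (lam : YoungDiagram) (T : lam.cells → Fin n) (i j : ℕ) :
    ext lam T i j < n ↔ (i, j) ∈ lam.cells := by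
  unfold ext; split_ifs with h
  · simp [h]
  · simp [h]

lemma ext_le {n : ℕ} (lam : YoungDiagram) (T : lam.cells → Fin n) (i j : ℕ) :
    ext lam T i j ≤ n := by
  unfold ext; split_ifs with h
  · exact (T _).2.le
  · rfl

lemma ext_row {n : ℕ} (lam : YoungDiagram) (T : lam.cells → Fin n) (hT : IsSsyt lam.cells T)
    (i j j' : ℕ) (h : j ≤ j') : ext lam T i j ≤ ext lam T i j' := by
  by_cases h' : (i, j') ∈ lam.cells
  · have h0 : (i, j) ∈ lam.cells := lam.up_left_mem le_rfl h h'
    have := hT.1 ⟨_, h0⟩ ⟨_, h'⟩ rfl h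
    simpa only [ext, h', h0, dif_pos, Fin.val_fin_le] using this
  · have := ext_le lam T i j
    simpa [ext, h'] using this

lemma ext_col {n : ℕ} (lam : YoungDiagram) (T : lam.cells → Fin n) (hT : IsSsyt lam.cells T)
    (i i' j : ℕ) (h : i < i') (hlt : ext lam T i' j ≤ n) (h2 : ext lam T i j < n) :
    ext lam T i j < ext lam T i' j := by
  by_cases h' : (i', j) ∈ lam.cells
  · have h0 : (i, j) ∈ lam.cells := lam.up_left_mem h.le le_rfl h'
    have := hT.2 ⟨_, h0⟩ ⟨_, h'⟩ h rfl
    simpa only [ext, h', h0, dif_pos, Fin.val_fin_lt] using this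
  · simpa [ext, h'] using h2

lemma ext_col' {n : ℕ} (lam : YoungDiagram) (T : lam.cells → Fin n) (hT : IsSsyt lam.cells T)
    (i i' j m : ℕ) (h : i < i') (hm : m + 1 ≤ n) (h2 : ext lam T i' j < m + 1) :
    ext lam T i j < m := by
  have h' : (i', j) ∈ lam.cells := (ext_lt lam T i' j).1 (by omega)
  have h0 : (i, j) ∈ lam.cells := lam.up_left_mem h.le le_rfl h'
  have := ext_col lam T hT i i' j h (by omega) ((ext_lt lam T i j).2 h0)
  omega

lemma exists_cut {n : ℕ} (lam : YoungDiagram) (T : lam.cells → Fin n) (hT : IsSsyt lam.cells T)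
    (m : ℕ) (hm : m ≤ n) : ∃ q : ℕ → ℕ, ∀ i j, ext lam T i j < m ↔ j < q i := by
  have ex : ∀ i, ∃ j, ¬ ext lam T i j < m := by
    intro i
    refine ⟨lam.rowLen i, fun h => ?_⟩
    have := (ext_lt lam T i (lam.rowLen i)).1 (by omega)
    rw [YoungDiagram.mem_cells, YoungDiagram.mem_iff_lt_rowLen] at this
    omega
  classical
  refine ⟨fun i => Nat.find (ex i), fun i j => ?_⟩
  rw [Nat.lt_find_iff]
  constructor
  · intro h j' hj'
    have := ext_row lam T hT i j' j hj'
    omega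
  · intro h
    have := h j le_rfl
    omega

/-- Collapse the values `k`, `k+1`. -/
def coll {n : ℕ} {s : Finset (ℕ × ℕ)} (k : ℕ) (T : s → Fin n) : s → ℕ :=
  fun c => if (T c : ℕ) = k + 1 then k else T c

/-- Tableau from cuts. -/
def cutT {n : ℕ} (lam : YoungDiagram) (hlam : lam.colLen 0 ≤ n) (T₀ : lam.cells → Fin n)
    (k : ℕ) (hk : k + 1 < n) (ν L : ℕ → ℕ) (p : Fin n → ℕ) : lam.cells → Fin n :=
  fun c => if ν c.1.1 ≤ c.1.2 ∧ c.1.2 < L c.1.1 then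
      (if c.1.2 < p ⟨c.1.1, lt_of_lt_of_le (YoungDiagram.mem_iff_lt_colLen.1
        (lam.up_left_mem le_rfl (Nat.zero_le _) ((YoungDiagram.mem_cells _).1 c.2))) hlam⟩
        then ⟨k, by omega⟩ else ⟨k+1, hk⟩)
    else T₀ c

lemma cell_row_lt {n : ℕ} {lam : YoungDiagram} (hlam : lam.colLen 0 ≤ n) {i j : ℕ}
    (h : (i, j) ∈ lam.cells) : i < n :=
  lt_of_lt_of_le (YoungDiagram.mem_iff_lt_colLen.1
        (lam.up_left_mem le_rfl (Nat.zero_le _) ((YoungDiagram.mem_cells _).1 h))) hlam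

lemma cutT_val {n : ℕ} (lam : YoungDiagram) (hlam : lam.colLen 0 ≤ n) (T₀ : lam.cells → Fin n)
    (k : ℕ) (hk : k + 1 < n) (ν L : ℕ → ℕ) (p : Fin n → ℕ) (c : lam.cells) :
    (cutT lam hlam T₀ k hk ν L p c : ℕ) = if ν c.1.1 ≤ c.1.2 ∧ c.1.2 < L c.1.1 then
      (if c.1.2 < p ⟨c.1.1, cell_row_lt hlam c.2⟩ then k else k + 1) else T₀ c := by
  unfold cutT; split_ifs <;> rfl

section Fiber

variable {n : ℕ} {lam : YoungDiagram} (hlam : lam.colLen 0 ≤ n) {T₀ : lam.cells → Fin n}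
    (hT₀ : IsSsyt lam.cells T₀) {k : ℕ} (hk : k + 1 < n) {ν L : ℕ → ℕ}
    (hν : ∀ i j, ext lam T₀ i j < k ↔ j < ν i) (hL : ∀ i j, ext lam T₀ i j < k + 2 ↔ j < L i)

lemma cutR_le (ν L : ℕ → ℕ) (i : ℕ) : cutR ν L i ≤ L i := by
  cases i with
  | zero => simp [cutR]
  | succ i => simp [cutR]

include hT₀ hk hν hL in
lemma cutT_ssyt {p : Fin n → ℕ} (hp : ∀ i : Fin n, cutL ν L i ≤ p i ∧ p i ≤ cutR ν L i) :
    IsSsyt lam.cells (cutT lam hlam T₀ k hk ν L p) := by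
  constructor
  · intro c c' h h'
    rw [← Fin.val_fin_le, cutT_val, cutT_val]
    have a1 := hν c.1.1 c.1.2
    have a2 := hν c'.1.1 c'.1.2
    have a3 := hL c.1.1 c.1.2
    have a4 := hL c'.1.1 c'.1.2
    have a5 := Fin.val_fin_le.2 (hT₀.1 c c' h h')
    rw [ext_cell] at a1 a2 a3 a4
    have e : (⟨c.1.1, cell_row_lt hlam c.2⟩ : Fin n) = ⟨c'.1.1, cell_row_lt hlam c'.2⟩ := by
      simp [h]
    rw [e]
    split_ifs <;> omega
  · intro c c' h h'
    rw [← Fin.val_fin_lt, cutT_val, cutT_val]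
    have a1 := hν c.1.1 c.1.2
    have a2 := hν c'.1.1 c'.1.2
    have a3 := hL c.1.1 c.1.2
    have a4 := hL c'.1.1 c'.1.2
    have a5 := Fin.val_fin_lt.2 (hT₀.2 c c' h h')
    rw [ext_cell] at a1 a2 a3 a4
    have b1 := (hp ⟨c.1.1, cell_row_lt hlam c.2⟩).1
    have b2 := (hp ⟨c'.1.1, cell_row_lt hlam c'.2⟩).2
    by_cases hs : c'.1.1 = c.1.1 + 1
    · have b3 : L c'.1.1 ≤ p ⟨c.1.1, cell_row_lt hlam c.2⟩ :=
        le_trans (by simp [cutL, hs]) b1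
      have b4 : p ⟨c'.1.1, cell_row_lt hlam c'.2⟩ ≤ ν c.1.1 :=
        le_trans b2 (by simp [hs, cutR])
      split_ifs <;> omega
    · have hm : (c.1.1 + 1, c.1.2) ∈ lam.cells :=
        lam.up_left_mem (i2 := c'.1.1) (j2 := c'.1.2) (by omega) h'.le c'.2
      have d1 := Fin.val_fin_lt.2 (hT₀.2 c ⟨_, hm⟩ (by simp) rfl)
      have d2 := Fin.val_fin_lt.2 (hT₀.2 ⟨_, hm⟩ c' (by simp; omega) h')
      split_ifs <;> omega

include hν hL in
lemma cutT_coll (p : Fin n → ℕ) : coll k (cutT lam hlam T₀ k hk ν L p) = coll k T₀ := by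
  funext c
  unfold coll
  rw [cutT_val]
  have a1 := hν c.1.1 c.1.2
  have a3 := hL c.1.1 c.1.2
  rw [ext_cell] at a1 a3
  split_ifs <;> omega

include hk hν hL in
lemma cutT_inj {p p' : Fin n → ℕ} (hp : ∀ i : Fin n, cutL ν L i ≤ p i ∧ p i ≤ cutR ν L i)
    (hp' : ∀ i : Fin n, cutL ν L i ≤ p' i ∧ p' i ≤ cutR ν L i)
    (h : cutT lam hlam T₀ k hk ν L p = cutT lam hlam T₀ k hk ν L p') : p = p' := by
  funext i
  have key : ∀ j, ν i ≤ j → j < L i → (j < p i ↔ j < p' i) := by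
    intro j h1 h2
    have hc : ((i : ℕ), j) ∈ lam.cells := (ext_lt lam T₀ i j).1 (by have := (hL i j).2 h2; omega)
    have := congrArg (fun T => ((T ⟨_, hc⟩ : Fin n) : ℕ)) h
    simp only [cutT_val, h1, h2, and_self, if_true] at this
    constructor <;> intro hh <;> split_ifs at this <;> omega
  have u1 := (hp i).1
  have u2 := (hp' i).1
  have u3 := (hp i).2.trans (cutR_le _ _ _)
  have u4 := (hp' i).2.trans (cutR_le _ _ _)
  have u5 : ν i ≤ cutL ν L i := le_max_left _ _
  by_contra hne
  rcases lt_or_gt_of_ne hne with hlt | hlt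
  · have := key (p i) (by omega) (by omega); omega
  · have := key (p' i) (by omega) (by omega); omega

include hk hν hL in
lemma cutT_surj {T : lam.cells → Fin n} (hT : IsSsyt lam.cells T) (hc : coll k T = coll k T₀) :
    ∃ p : Fin n → ℕ, (∀ i : Fin n, cutL ν L i ≤ p i ∧ p i ≤ cutR ν L i) ∧
      cutT lam hlam T₀ k hk ν L p = T := by
  obtain ⟨q, hq⟩ := exists_cut lam T hT (k+1) (by omega)
  have hcc : ∀ c, (if (T c : ℕ) = k + 1 then k else (T c : ℕ)) =
      if (T₀ c : ℕ) = k + 1 then k else (T₀ c : ℕ) := fun c => congrFun hc c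
  have f1 : ∀ i j, ext lam T i j < k ↔ j < ν i := by
    intro i j
    rw [← hν]
    by_cases h : (i, j) ∈ lam.cells
    · have := hcc ⟨_, h⟩
      simp only [ext, h, dif_pos]
      split_ifs at this <;> omega
    · simp [ext, h]
  have f2 : ∀ i j, ext lam T i j < k + 2 ↔ j < L i := by
    intro i j
    rw [← hL]
    by_cases h : (i, j) ∈ lam.cells
    · have := hcc ⟨_, h⟩
      simp only [ext, h, dif_pos]
      split_ifs at this <;> omega
    · simp [ext, h]
  refine ⟨fun i => q i, fun i => ⟨max_le ?_ ?_, ?_⟩, ?_⟩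
  · by_contra! hh
    have := (f1 i (q i)).2 hh
    have := (hq i (q i)).1 (by omega)
    omega
  · by_contra! hh
    have := (f2 (i+1) (q i)).2 hh
    have := ext_col' lam T hT i (i+1) (q i) (k+1) (by omega) (by omega) this
    have := (hq i (q i)).1 this
    omega
  · have g1 : ∀ i, q i ≤ L i := by
      intro i
      by_contra! hh
      have := (hq i (L i)).2 hh
      have := (f2 i (L i)).1 (by omega)
      omega
    have g2 : ∀ i, q (i+1) ≤ ν i := by
      intro i
      by_contra! hh
      have := (hq (i+1) (ν i)).2 hh
      have := ext_col' lam T hT i (i+1) (ν i) k (by omega) (by omega) this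
      have := (f1 i (ν i)).1 this
      omega
    obtain ⟨i, hi⟩ := i
    cases i with
    | zero => exact g1 0
    | succ i => exact le_min (g1 _) (g2 _)
  · funext c
    apply Fin.ext
    rw [cutT_val]
    have a1 := f1 c.1.1 c.1.2
    have a2 := f2 c.1.1 c.1.2
    have a3 := hq c.1.1 c.1.2
    have a4 := hcc c
    rw [ext_cell] at a1 a2 a3
    dsimp only
    split_ifs at a4 ⊢ <;> omega

open Finset in
lemma prod_cells {A : Type} [CommRing A] (hlam : lam.colLen 0 ≤ n) (f : ℕ → ℕ → A) :
    ∏ c : lam.cells, f c.1.1 c.1.2 = ∏ i ∈ range n, ∏ j ∈ range (lam.rowLen i), f i j := by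
  rw [Finset.prod_coe_sort lam.cells (fun c => f c.1 c.2), Finset.prod_sigma']
  refine Finset.prod_bij' (fun c _ => ⟨c.1, c.2⟩) (fun c _ => (c.1, c.2)) ?_ ?_ ?_ ?_ ?_
  · rintro ⟨i, j⟩ h
    simp only [mem_sigma, mem_range]
    exact ⟨cell_row_lt hlam h, YoungDiagram.mem_iff_lt_rowLen.1 ((YoungDiagram.mem_cells _).1 h)⟩
  · rintro ⟨i, j⟩ h
    simp only [mem_sigma, mem_range] at h
    exact (YoungDiagram.mem_cells _).2 (YoungDiagram.mem_iff_lt_rowLen.2 h.2)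
  · simp
  · simp
  · simp

/-- weight of a tableau -/
noncomputable def wt {A : Type} [CommRing A] {n : ℕ} (s : Finset (ℕ × ℕ)) (x : Fin n → A)
    (a : ℤ → A) (T : s → Fin n) : A :=
  ∏ c : s, (x (T c) - a ((T c : ℤ) + 1 + ((c : ℕ × ℕ).2 : ℤ) - ((c : ℕ × ℕ).1 : ℤ)))

open Finset in
include hk hν hL in
lemma cutT_wt {A : Type} [CommRing A] (x : Fin n → A) (a : ℤ → A) {p : Fin n → ℕ}
    (hp : ∀ i : Fin n, cutL ν L i ≤ p i ∧ p i ≤ cutR ν L i) :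
    wt lam.cells x a (cutT lam hlam T₀ k hk ν L p) =
    (∏ c : lam.cells, if ν c.1.1 ≤ c.1.2 ∧ c.1.2 < L c.1.1 then 1 else
      (x (T₀ c) - a ((T₀ c : ℤ) + 1 + (c.1.2 : ℤ) - (c.1.1 : ℤ)))) *
    ∏ i : Fin n, ((∏ j ∈ Ico (ν i) (p i), (x ⟨k, by omega⟩ - a (k + 1 + j - (i : ℕ)))) *
      ∏ j ∈ Ico (p i) (L i), (x ⟨k+1, hk⟩ - a (k + 2 + j - (i : ℕ)))) := by
  set P : ℕ → ℕ := fun i => if h : i < n then p ⟨i, h⟩ else 0 with hP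
  have hPi : ∀ i : Fin n, P i = p i := fun i => by simp [hP]
  have e1 : ∏ i : Fin n, ((∏ j ∈ Ico (ν i) (p i), (x ⟨k, by omega⟩ - a (k + 1 + j - (i : ℕ)))) *
      ∏ j ∈ Ico (p i) (L i), (x ⟨k+1, hk⟩ - a (k + 2 + j - (i : ℕ)))) =
    ∏ c : lam.cells, if ν c.1.1 ≤ c.1.2 ∧ c.1.2 < L c.1.1 then
      (if c.1.2 < P c.1.1 then (x ⟨k, by omega⟩ - a (k + 1 + c.1.2 - c.1.1)) else
        (x ⟨k+1, hk⟩ - a (k + 2 + c.1.2 - c.1.1))) else 1 := by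
    rw [prod_cells hlam (fun i j => if ν i ≤ j ∧ j < L i then
      (if j < P i then (x ⟨k, by omega⟩ - a (k + 1 + j - i)) else
        (x ⟨k+1, hk⟩ - a (k + 2 + j - i))) else 1), Finset.prod_range]
    refine prod_congr rfl fun i _ => ?_
    rw [← prod_filter]
    have hset : (range (lam.rowLen i)).filter (fun j => ν i ≤ j ∧ j < L i) = Ico (ν i) (L i) := by
      ext j
      simp only [mem_filter, mem_range, mem_Ico]
      refine ⟨fun h => h.2, fun h => ⟨?_, h⟩⟩
      have := (hL i j).2 h.2
      exact YoungDiagram.mem_iff_lt_rowLen.1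
        ((YoungDiagram.mem_cells _).1 ((ext_lt lam T₀ i j).1 (by omega)))
    have h1 : ν i ≤ p i := le_trans (le_max_left _ _) (hp i).1
    have h2 : p i ≤ L i := le_trans (hp i).2 (cutR_le _ _ _)
    rw [hset, ← prod_Ico_consecutive _ h1 h2, hPi]
    congr 1
    · refine prod_congr rfl fun j hj => ?_
      rw [if_pos (mem_Ico.1 hj).2]
    · refine prod_congr rfl fun j hj => ?_
      rw [if_neg (by have := (mem_Ico.1 hj).1; omega)]
  rw [e1, ← prod_mul_distrib, wt]
  refine prod_congr rfl fun c _ => ?_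
  have hPc : P c.1.1 = p ⟨c.1.1, cell_row_lt hlam c.2⟩ := hPi ⟨c.1.1, cell_row_lt hlam c.2⟩
  rw [hPc]
  unfold cutT
  split_ifs
  · simp
  · simp only [one_mul]; congr 2
  · simp

open Finset in
include hlam hT₀ hk hν hL in
open Classical in
lemma fiber_sum {A : Type} [CommRing A] (x : Fin n → A) (a : ℤ → A) :
    ∑ T : lam.cells → Fin n with IsSsyt lam.cells T ∧ coll k T = coll k T₀, wt lam.cells x a T =
    (∏ c : lam.cells, if ν c.1.1 ≤ c.1.2 ∧ c.1.2 < L c.1.1 then 1 else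
      (x (T₀ c) - a ((T₀ c : ℤ) + 1 + (c.1.2 : ℤ) - (c.1.1 : ℤ)))) *
    ∏ i ∈ range n, ∑ p ∈ Icc (cutL ν L i) (cutR ν L i),
      (∏ j ∈ Ico (ν i) p, (x ⟨k, by omega⟩ - a (k + 1 + j - i))) *
      ∏ j ∈ Ico p (L i), (x ⟨k+1, hk⟩ - a (k + 2 + j - i)) := by
  rw [Finset.prod_range (n := n), Finset.prod_univ_sum, mul_sum]
  symm
  refine Finset.sum_bij (fun p _ => cutT lam hlam T₀ k hk ν L p) ?_ ?_ ?_ ?_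
  · intro p hp
    simp only [Fintype.mem_piFinset, mem_Icc] at hp
    simp only [mem_filter, mem_univ, true_and]
    exact ⟨cutT_ssyt hlam hT₀ hk hν hL hp, cutT_coll hlam hk hν hL p⟩
  · intro p hp p' hp' h
    simp only [Fintype.mem_piFinset, mem_Icc] at hp hp'
    exact cutT_inj hlam hk hν hL hp hp' h
  · intro T hT
    simp only [mem_filter, mem_univ, true_and] at hT
    obtain ⟨p, hp, hpT⟩ := cutT_surj hlam hk hν hL hT.1 hT.2
    exact ⟨p, by simpa only [Fintype.mem_piFinset, mem_Icc] using hp, hpT⟩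
  · intro p hp
    simp only [Fintype.mem_piFinset, mem_Icc] at hp
    exact (cutT_wt hlam hk hν hL x a hp).symm

end Fiber

open Classical in
lemma sgen_eq {A : Type} [CommRing A] (n : ℕ) (s : Finset (ℕ × ℕ)) (x : Fin n → A) (a : ℤ → A) :
    sgen n s x a = ∑ T : s → Fin n with IsSsyt s T, wt s x a T := by
  unfold sgen wt
  rw [finsum_mem_eq_finite_toFinset_sum _ (Set.toFinite _)]
  refine Finset.sum_congr ?_ fun _ _ => rfl
  ext T; simp

open Finset in
open Classical in
lemma sgen_swap {A : Type} [CommRing A] [IsDomain A] {n : ℕ} {lam : YoungDiagram}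
    (hlam : lam.colLen 0 ≤ n) (x : Fin n → A) (a : ℤ → A) (k : ℕ) (hk : k + 1 < n) :
    sgen n lam.cells (x ∘ Equiv.swap ⟨k, by omega⟩ ⟨k+1, hk⟩) a = sgen n lam.cells x a := by
  rw [sgen_eq, sgen_eq, ← Finset.sum_fiberwise_of_maps_to
      (t := univ.image (coll k)) (g := coll (s := lam.cells) (n := n) k) (fun T _ => mem_image_of_mem _ (mem_univ T)),
    ← Finset.sum_fiberwise_of_maps_to (s := univ.filter (IsSsyt lam.cells))
      (t := univ.image (coll k)) (g := coll (s := lam.cells) (n := n) k) (fun T _ => mem_image_of_mem _ (mem_univ T))]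
  refine sum_congr rfl fun U _ => ?_
  rw [filter_filter]
  by_cases hne : ∃ T₀ : lam.cells → Fin n, IsSsyt lam.cells T₀ ∧ coll k T₀ = U
  · obtain ⟨T₀, hT₀, rfl⟩ := hne
    obtain ⟨ν, hν⟩ := exists_cut lam T₀ hT₀ k (by omega)
    obtain ⟨L, hL⟩ := exists_cut lam T₀ hT₀ (k+2) (by omega)
    rw [fiber_sum hlam hT₀ hk hν hL, fiber_sum hlam hT₀ hk hν hL]
    have hL0 : ∀ i, n ≤ i → L i = 0 := by
      intro i hi
      by_contra hh
      have := (hL i 0).2 (by omega)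
      have := cell_row_lt hlam ((ext_lt lam T₀ i 0).1 (by omega))
      omega
    have := rows_symm n ν L hL0 a k (x ⟨k, by omega⟩) (x ⟨k+1, hk⟩)
    rw [this]
    simp only [Function.comp_apply, Equiv.swap_apply_left, Equiv.swap_apply_right]
    congr 1
    refine prod_congr rfl fun c _ => ?_
    split_ifs with h
    · rfl
    · have a1 := hν c.1.1 c.1.2
      have a3 := hL c.1.1 c.1.2
      rw [ext_cell] at a1 a3
      rw [Equiv.swap_apply_of_ne_of_ne]
      · intro e; have := congrArg Fin.val e; simp only at this; omega
      · intro e; have := congrArg Fin.val e; simp only at this; omega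
  · rw [filter_eq_empty_iff.2, sum_empty, sum_empty]
    intro T _ hT
    exact hne ⟨T, hT⟩

lemma sgen_perm {A : Type} [CommRing A] [IsDomain A] {n : ℕ} {lam : YoungDiagram}
    (hlam : lam.colLen 0 ≤ n) (a : ℤ → A) (σ : Equiv.Perm (Fin n)) :
    ∀ x : Fin n → A, sgen n lam.cells (x ∘ σ) a = sgen n lam.cells x a := by
  cases n with
  | zero => intro x; congr 1; exact Subsingleton.elim _ _
  | succ m =>
    have h : σ ∈ Submonoid.closure
        (Set.range fun i : Fin m ↦ Equiv.swap i.castSucc i.succ) := by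
      rw [Equiv.Perm.mclosure_swap_castSucc_succ]; trivial
    induction h using Submonoid.closure_induction with
    | mem s hs =>
      obtain ⟨i, rfl⟩ := hs
      intro x
      exact sgen_swap hlam x a i (by omega)
    | one => intro x; rfl
    | mul s t _ _ ihs iht =>
      intro x
      rw [Equiv.Perm.coe_mul, ← Function.comp_assoc, iht, ihs]

/-- The unique surviving tableau. -/
def bot {n : ℕ} (lam : YoungDiagram) (hlam : lam.colLen 0 ≤ n) : lam.cells → Fin n :=
  fun c => ⟨n - lam.colLen c.1.2 + c.1.1, by
    have h1 : c.1.1 < lam.colLen c.1.2 := YoungDiagram.mem_iff_lt_colLen.1 c.2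
    have h2 := lam.colLen_anti 0 c.1.2 (Nat.zero_le _)
    omega⟩

lemma bot_ssyt {n : ℕ} (lam : YoungDiagram) (hlam : lam.colLen 0 ≤ n) :
    IsSsyt lam.cells (bot lam hlam) := by
  constructor
  · intro c c' h h'
    have := lam.colLen_anti _ _ h'
    simp only [bot, Fin.mk_le_mk]
    omega
  · intro c c' h h'
    simp only [bot, Fin.mk_lt_mk, h']
    omega

lemma col_add {n : ℕ} {lam : YoungDiagram} {T : lam.cells → Fin n} (hT : IsSsyt lam.cells T)
    (i j d : ℕ) (h : (i + d, j) ∈ lam.cells) : ext lam T i j + d ≤ ext lam T (i + d) j := by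
  induction d with
  | zero => simp
  | succ d ih =>
    have h0 : (i + d, j) ∈ lam.cells := lam.up_left_mem (by omega) le_rfl h
    have := ih h0
    have := ext_col lam T hT (i + d) (i + (d + 1)) j (by omega) (ext_le _ _ _ _)
      ((ext_lt _ _ _ _).2 h0)
    omega

lemma eq_bot {n : ℕ} {lam : YoungDiagram} (hlam : lam.colLen 0 ≤ n) {T : lam.cells → Fin n}
    (hT : IsSsyt lam.cells T)
    (hnz : ∀ c : lam.cells, (lam.rowLen (n - 1 - T c) : ℤ) ≠ c.1.2 - c.1.1) :
    T = bot lam hlam := by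
  have up : ∀ i j, (i, j) ∈ lam.cells → ext lam T i j ≤ n - lam.colLen j + i := by
    intro i j h
    have h1 : i < lam.colLen j := YoungDiagram.mem_iff_lt_colLen.1 h
    have h2 : (i + (lam.colLen j - 1 - i), j) ∈ lam.cells :=
      YoungDiagram.mem_iff_lt_colLen.2 (by omega)
    have := col_add hT i j _ h2
    have := (ext_lt lam T _ _).2 h2
    omega
  have nz0 : ∀ j, (0, j) ∈ lam.cells → lam.rowLen (n - 1 - ext lam T 0 j) ≠ j := by
    intro j h e
    have := hnz ⟨_, h⟩
    simp only [ext, h, dif_pos] at e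
    simp [e] at this
  have low : ∀ j, (0, j) ∈ lam.cells → j < lam.rowLen (n - 1 - ext lam T 0 j) := by
    intro j
    induction j with
    | zero => intro h; have := nz0 0 h; omega
    | succ j ih =>
      intro h
      have h0 : (0, j) ∈ lam.cells := lam.up_left_mem le_rfl (by omega) h
      have h1 := ih h0
      have h2 := ext_row lam T hT 0 j (j+1) (by omega)
      have h3 := lam.rowLen_anti (n - 1 - ext lam T 0 (j+1)) (n - 1 - ext lam T 0 j) (by omega)
      have := nz0 _ h
      omega
  funext c
  apply Fin.ext
  obtain ⟨⟨i, j⟩, h⟩ := c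
  have e : ext lam T i j = (T ⟨(i, j), h⟩ : ℕ) := ext_cell lam T ⟨(i, j), h⟩
  rw [← e]
  simp only [bot]
  have h0 : (0, j) ∈ lam.cells := lam.up_left_mem (Nat.zero_le _) le_rfl h
  have h1 := YoungDiagram.mem_iff_lt_colLen.1 (YoungDiagram.mem_iff_lt_rowLen.2 (low j h0))
  have h2 := col_add hT 0 j i (by simpa using h)
  rw [Nat.zero_add] at h2
  have h3 := up i j h
  have h4 := lam.colLen_anti 0 j (Nat.zero_le _)
  omega

/-- **Vanishing Theorem, part 2.**
`s_λ(a_λ|a) = ∏_{(i,j)∈λ} (a_{λ_i+n−i+1} − a_{n−λ^t_j+j})` in `ℤ[a_i : i ∈ ℤ]`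
(cells `(i,j)` are `0`-based, so row `i` has part `λ.rowLen i = λ_{i+1}` and column `j`
has conjugate part `λ.colLen j = λ^t_{j+1}`). -/
theorem vanishing_diagonal (n : ℕ) (hn : 1 ≤ n) (lam : YoungDiagram)
    (hlam : lam.colLen 0 ≤ n) :
    sgen n lam.cells (subA n (fun k => (MvPolynomial.X k : MvPolynomial ℤ ℤ)) lam)
      (fun k => MvPolynomial.X k) =
    ∏ c ∈ lam.cells,
      (MvPolynomial.X ((lam.rowLen c.1 : ℤ) + (n : ℤ) - (c.1 : ℤ))
        - MvPolynomial.X ((n : ℤ) - (lam.colLen c.2 : ℤ) + (c.2 : ℤ) + 1)) := by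
  classical
  rw [← sgen_perm hlam _ Fin.revPerm, sgen_eq, Finset.sum_eq_single (bot lam hlam)]
  · unfold wt
    rw [Finset.prod_coe_sort_eq_attach]
    have hin : ∀ c ∈ lam.cells, (lam.colLen c.2 - 1 - c.1, c.2) ∈ lam.cells := by
      rintro ⟨i, j⟩ h
      have h1 : i < lam.colLen j := YoungDiagram.mem_iff_lt_colLen.1 h
      exact YoungDiagram.mem_iff_lt_colLen.2 (by simp only; omega)
    refine Finset.prod_bij' (fun c _ => (lam.colLen c.1.2 - 1 - c.1.1, c.1.2))
      (fun c hc => ⟨(lam.colLen c.2 - 1 - c.1, c.2), hin c hc⟩) ?_ ?_ ?_ ?_ ?_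
    · intro c _; exact hin _ c.2
    · intro c _; exact Finset.mem_attach _ _
    · rintro ⟨⟨i, j⟩, h⟩ _
      have h1 : i < lam.colLen j := YoungDiagram.mem_iff_lt_colLen.1 h
      simp only [Subtype.mk.injEq, Prod.mk.injEq, and_true]
      omega
    · rintro ⟨i, j⟩ h
      have h1 : i < lam.colLen j := YoungDiagram.mem_iff_lt_colLen.1 h
      simp only [Prod.mk.injEq, and_true]
      omega
    · rintro ⟨⟨i, j⟩, h⟩ _
      have h1 : i < lam.colLen j := YoungDiagram.mem_iff_lt_colLen.1 h
      have h2 := lam.colLen_anti 0 j (Nat.zero_le _)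
      have e : n - (n - lam.colLen j + i + 1) = lam.colLen j - 1 - i := by omega
      simp only [subA, bot, Function.comp_apply, Fin.revPerm_apply, Fin.val_rev, e]
      congr 2
      push_cast [h2.trans hlam]
      ring
  · intro T hT hne
    rw [Finset.mem_filter] at hT
    by_contra hw
    apply hne
    refine eq_bot hlam hT.2 fun c hc => hw ?_
    refine Finset.prod_eq_zero (Finset.mem_univ c) ?_
    have h2 : n - ((T c : ℕ) + 1) = n - 1 - T c := by omega
    simp only [subA, Function.comp_apply, Fin.revPerm_apply, Fin.val_rev, h2]
    rw [sub_eq_zero, hc]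
    congr 1
    have := (T c).2
    omega
  · intro h
    exact absurd (Finset.mem_filter.2 ⟨Finset.mem_univ _, bot_ssyt lam hlam⟩) h

end FactorialLR
end

section
/- Let n ≥ 1 and let μ ⊆ ν be partitions with at most n parts. Then, in the field ℚ(a_i : i ∈ ℤ) of rational functions, s_μ(a_ν|a) / s_ν(a_ν|a) = Σ over all chains μ = ρ^{(0)} → ρ^{(1)} → ⋯ → ρ^{(l−1)} → ρ^{(l)} = ν (where l = |ν| − |μ|) of the product ∏_{i=0}^{l−1} 1/(|a_ν| − |a_{ρ^{(i)}}|); equivalently, s_μ(a_ν|a) = s_ν(a_ν|a)·H(μ,ν). -/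
open scoped BigOperators

namespace FactorialLR

/-- `|a_ρ| = a_{ρ_1+n} + ⋯ + a_{ρ_n+1}`. -/
noncomputable def aNorm {A : Type} [CommRing A] (n : ℕ) (a : ℤ → A) (ρ : YoungDiagram) : A :=
  ∑ i : Fin n, subA n a ρ i

/-- `μ → ν` : `ν` is obtained from `μ` by adding a single cell. -/
def Covers (μ ν : YoungDiagram) : Prop :=
  μ ≤ ν ∧ ν.card = μ.card + 1

/-- Chains `μ = ρ⁽⁰⁾ → ρ⁽¹⁾ → ⋯ → ρ⁽ˡ⁾ = ν` of Young diagrams, encoded as lists. -/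
def chainSet (μ ν : YoungDiagram) : Set (List YoungDiagram) :=
  {L | L.Chain' Covers ∧ L.head? = some μ ∧ L.getLast? = some ν}

/-- `H(μ,ρ)`: the sum over all chains `μ = ρ⁽⁰⁾ → ⋯ → ρ⁽ʳ⁾ = ρ` of
`∏_{i=0}^{r-1} 1/(|a_ρ| − |a_{ρ⁽ⁱ⁾}|)`; in particular `H(μ,μ) = 1`. -/
noncomputable def H {K : Type} [Field K] (n : ℕ) (a : ℤ → K) (μ ρ : YoungDiagram) : K :=
  ∑ᶠ L ∈ chainSet μ ρ,
    (L.dropLast.map fun σ => (aNorm n a ρ - aNorm n a σ)⁻¹).prod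

/-- The field `ℚ(a_i : i ∈ ℤ)` of rational functions in the variables `a_i`, `i ∈ ℤ`. -/
noncomputable abbrev Kfield : Type := FractionRing (MvPolynomial ℤ ℚ)

/-- The variables `a_i`, `i ∈ ℤ`, as elements of `Kfield`. -/
noncomputable def aK : ℤ → Kfield :=
  fun k => algebraMap (MvPolynomial ℤ ℚ) Kfield (MvPolynomial.X k)

section DetPart

variable {K : Type} [Field K]

/-- Factorial power `∏_{k < m} (y - b_k)`. -/
noncomputable def fp (b : ℕ → K) (m : ℕ) (y : K) : K := ∏ k ∈ Finset.range m, (y - b k)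

/-- The alternant matrix. -/
noncomputable def altM {n : ℕ} (b : ℕ → K) (l : Fin n → ℕ) (x : Fin n → K) :
    Matrix (Fin n) (Fin n) K := Matrix.of fun i j => fp b (l i) (x j)

/-- Vandermonde product, defined recursively. -/
noncomputable def vd : (n : ℕ) → (Fin n → K) → K
  | 0, _ => 1
  | n + 1, x => vd n (fun i => x i.castSucc) * ∏ j : Fin n, (x j.castSucc - x (Fin.last n))

lemma vd_ne_zero : ∀ (n : ℕ) (x : Fin n → K), Function.Injective x → vd n x ≠ 0
  | 0, _, _ => one_ne_zero
  | n + 1, x, h => by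
    refine mul_ne_zero (vd_ne_zero n _ fun i j hij => Fin.castSucc_injective _ (h hij)) ?_
    refine Finset.prod_ne_zero_iff.2 fun j _ => sub_ne_zero.2 fun hj => ?_
    exact (Fin.castSucc_lt_last j).ne (h hj)

lemma fp_succ (b : ℕ → K) (m : ℕ) (y : K) : fp b (m + 1) y = fp b m y * (y - b m) :=
  Finset.prod_range_succ _ _

lemma fp_diff (b : ℕ → K) (p q : ℕ) (h : p ≤ q) (y z : K) :
    fp b q z - (∏ k ∈ Finset.Ico p q, (y - b k)) * fp b p z =
      (z - y) * ∑ m ∈ Finset.Ico p q, (∏ k ∈ Finset.Ico (m + 1) q, (y - b k)) * fp b m z := by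
  induction q, h using Nat.le_induction with
  | base => simp
  | succ q hq ih =>
    rw [Finset.prod_Ico_succ_top hq, Finset.sum_Ico_succ_top hq, fp_succ]
    have : ∑ m ∈ Finset.Ico p q, (∏ k ∈ Finset.Ico (m + 1) (q + 1), (y - b k)) * fp b m z
        = (∑ m ∈ Finset.Ico p q, (∏ k ∈ Finset.Ico (m + 1) q, (y - b k)) * fp b m z)
          * (y - b q) := by
      rw [Finset.sum_mul]
      refine Finset.sum_congr rfl fun m hm => ?_
      rw [Finset.prod_Ico_succ_top (by simp at hm; omega)]; ring
    rw [this, mul_add, ← mul_assoc, ← ih]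
    simp
    ring

lemma fp_split (b : ℕ → K) (p q : ℕ) (h : p ≤ q) (y : K) :
    fp b q y = (∏ k ∈ Finset.Ico p q, (y - b k)) * fp b p y := by
  rw [fp, fp, mul_comm, Finset.prod_range_mul_prod_Ico _ h]

lemma det_row_ops {n : ℕ} (A B : Matrix (Fin (n + 1)) (Fin (n + 1)) K) (c : Fin n → K)
    (h0 : ∀ j, A (Fin.last n) j = B (Fin.last n) j)
    (h1 : ∀ (i : Fin n) j, A i.castSucc j = B i.castSucc j + c i * A i.succ j) :
    A.det = B.det := by
  rw [← Matrix.det_submatrix_equiv_self Fin.revPerm A,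
    ← Matrix.det_submatrix_equiv_self Fin.revPerm B]
  refine Matrix.det_eq_of_forall_row_eq_smul_add_pred (fun i => c i.rev) ?_ ?_
  · intro j; simpa using h0 _
  · intro i j
    simpa [Fin.rev_succ, Fin.rev_castSucc] using h1 i.rev j.rev

lemma det_last_col {n : ℕ} (A : Matrix (Fin (n + 1)) (Fin (n + 1)) K)
    (h : ∀ i : Fin n, A i.castSucc (Fin.last n) = 0) :
    A.det = A (Fin.last n) (Fin.last n) *
      (Matrix.of fun (i j : Fin n) => A i.castSucc j.castSucc).det := by
  rw [Matrix.det_succ_column A (Fin.last n), Fin.sum_univ_castSucc]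
  simp only [h, mul_zero, zero_mul, Finset.sum_const_zero, zero_add]
  have : (-1 : K) ^ (((Fin.last n : Fin (n+1)) : ℕ) + ((Fin.last n : Fin (n+1)) : ℕ)) = 1 :=
    Even.neg_one_pow ⟨_, rfl⟩
  rw [this, one_mul, Fin.succAbove_last]
  rfl

lemma det_branch {n : ℕ} (b : ℕ → K) (l : Fin (n + 1) → ℕ) (x : Fin (n + 1) → K)
    (hl : ∀ i : Fin n, l i.succ ≤ l i.castSucc) :
    (altM b l x).det = (∏ j : Fin n, (x j.castSucc - x (Fin.last n))) *
      ∑ m ∈ Fintype.piFinset (fun i : Fin n => Finset.Ico (l i.succ) (l i.castSucc)),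
        (altM b m (fun i => x i.castSucc)).det *
          ((∏ i : Fin n, ∏ k ∈ Finset.Ico (m i + 1) (l i.castSucc), (x (Fin.last n) - b k)) *
            fp b (l (Fin.last n)) (x (Fin.last n))) := by
  set y := x (Fin.last n) with hy
  let c : Fin n → K := fun i => ∏ k ∈ Finset.Ico (l i.succ) (l i.castSucc), (y - b k)
  let B : Matrix (Fin (n + 1)) (Fin (n + 1)) K := Matrix.of fun i j =>
    Fin.lastCases (motive := fun _ => K) (altM b l x (Fin.last n) j)
      (fun i' => altM b l x i'.castSucc j - c i' * altM b l x i'.succ j) i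
  have hAB : (altM b l x).det = B.det := by
    refine det_row_ops _ _ c ?_ ?_
    · intro j; simp [B]
    · intro i j; simp [B]
  have hB0 : ∀ i : Fin n, B i.castSucc (Fin.last n) = 0 := by
    intro i
    simp only [B, altM, Matrix.of_apply, Fin.lastCases_castSucc, c, ← hy]
    rw [fp_split b _ _ (hl i)]; ring
  rw [hAB, det_last_col B hB0]
  have hBll : B (Fin.last n) (Fin.last n) = fp b (l (Fin.last n)) y := by
    simp [B, altM, hy]
  have h2 : (Matrix.of fun (i j : Fin n) => B i.castSucc j.castSucc).det =
      (∏ j : Fin n, (x j.castSucc - y)) *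
        ∑ m ∈ Fintype.piFinset (fun i : Fin n => Finset.Ico (l i.succ) (l i.castSucc)),
        (∏ i : Fin n, ∏ k ∈ Finset.Ico (m i + 1) (l i.castSucc), (y - b k)) *
          (altM b m (fun i => x i.castSucc)).det := by
    have e1 : (Matrix.of fun (i j : Fin n) => B i.castSucc j.castSucc) =
        Matrix.of fun (i j : Fin n) => (x j.castSucc - y) *
          (Matrix.of (fun i : Fin n => ∑ m ∈ Finset.Ico (l i.succ) (l i.castSucc),
            ((∏ k ∈ Finset.Ico (m + 1) (l i.castSucc), (y - b k)) •
              (fun j : Fin n => fp b m (x j.castSucc))))) i j := by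
      ext i j
      simp only [B, altM, Matrix.of_apply, Fin.lastCases_castSucc, c, Finset.sum_apply,
        Pi.smul_apply, smul_eq_mul]
      exact fp_diff b _ _ (hl i) _ _
    rw [e1, Matrix.det_mul_row]
    congr 1
    have := (Matrix.detRowAlternating (n := Fin n) (R := K)).toMultilinearMap.map_sum_finset
      (fun (i : Fin n) (m : ℕ) => ((∏ k ∈ Finset.Ico (m + 1) (l i.castSucc), (y - b k)) •
              (fun j : Fin n => fp b m (x j.castSucc))))
      (fun i : Fin n => Finset.Ico (l i.succ) (l i.castSucc))
    refine Eq.trans this ?_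
    refine Finset.sum_congr rfl fun m _ => ?_
    exact (Matrix.detRowAlternating (n := Fin n) (R := K)).toMultilinearMap.map_smul_univ
      (fun i => ∏ k ∈ Finset.Ico (m i + 1) (l i.castSucc), (y - b k))
      (fun i => (fun j : Fin n => fp b (m i) (x j.castSucc)))
  rw [h2, hBll, mul_left_comm, Finset.mul_sum]
  congr 1
  refine Finset.sum_congr rfl fun m _ => ?_
  ring

lemma sum_det_updateRow {n : ℕ} (A : Matrix (Fin n) (Fin n) K) (v : Fin n → K) :
    ∑ i, (A.updateRow i (fun j => v j * A i j)).det = (∑ j, v j) * A.det := by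
  have h : ∀ i, (A.updateRow i (fun j => v j * A i j)).det =
      ∑ j, v j * (A i j * A.adjugate j i) := by
    intro i
    rw [← Matrix.cramer_transpose_apply, Matrix.cramer_eq_adjugate_mulVec,
      ← Matrix.adjugate_transpose]
    simp only [Matrix.mulVec, dotProduct, Matrix.transpose_apply]
    exact Finset.sum_congr rfl fun j _ => by ring
  simp only [h]
  rw [Finset.sum_comm, Finset.sum_mul]
  refine Finset.sum_congr rfl fun j _ => ?_
  rw [← Finset.mul_sum, ← Matrix.det_eq_sum_mul_adjugate_col]

lemma det_pieri {n : ℕ} (b : ℕ → K) (l : Fin n → ℕ) (x : Fin n → K) :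
    ∑ i, (altM b (Function.update l i (l i + 1)) x).det =
      ((∑ j, x j) - ∑ i, b (l i)) * (altM b l x).det := by
  rw [sub_mul, ← sum_det_updateRow, Finset.sum_mul, ← Finset.sum_sub_distrib]
  refine Finset.sum_congr rfl fun i _ => ?_
  have h1 : altM b (Function.update l i (l i + 1)) x =
      (altM b l x).updateRow i ((fun j => x j * altM b l x i j) + (- b (l i)) • altM b l x i) := by
    ext i' j
    by_cases h : i' = i
    · subst h; simp [altM, fp_succ]; ring
    · simp [altM, h]
  rw [h1, Matrix.det_updateRow_add, Matrix.det_updateRow_smul, Matrix.updateRow_eq_self]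
  ring

lemma det_vanish {n : ℕ} (A : Matrix (Fin n) (Fin n) K) (i : Fin n)
    (h : ∀ i' j, i' ≤ i → i ≤ j → A i' j = 0) : A.det = 0 := by
  rw [Matrix.det_apply]
  refine Finset.sum_eq_zero fun σ _ => ?_
  have : ∃ j, i ≤ j ∧ σ j ≤ i := by
    by_contra! hc
    have h1 : (Finset.Ici i).image σ ⊆ Finset.Ioi i := by
      intro k hk
      simp only [Finset.mem_image, Finset.mem_Ici, Finset.mem_Ioi] at hk ⊢
      obtain ⟨j, hj, rfl⟩ := hk
      exact hc j hj
    have h2 := Finset.card_le_card h1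
    rw [Finset.card_image_of_injective _ σ.injective, Fin.card_Ici, Fin.card_Ioi] at h2
    have := i.2
    omega
  obtain ⟨j, hj, hj'⟩ := this
  have h0 : ∏ k, A (σ k) k = 0 :=
    Finset.prod_eq_zero (f := fun k => A (σ k) k) (Finset.mem_univ j) (h _ _ hj' hj)
  rw [h0, smul_zero]

end DetPart

section Branch

open Classical in
lemma sgen_eq_sum {A : Type} [CommRing A] (n : ℕ) (s : Finset (ℕ × ℕ))
    (x : Fin n → A) (a : ℤ → A) :
    sgen n s x a = ∑ T ∈ Finset.univ.filter (fun T : s → Fin n => IsSsyt s T),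
      ∏ c : s, (x (T c) - a ((T c : ℤ) + 1 + ((c : ℕ × ℕ).2 : ℤ) - ((c : ℕ × ℕ).1 : ℤ))) := by
  rw [sgen, finsum_mem_eq_finite_toFinset_sum _ (Set.toFinite _)]
  refine Finset.sum_congr ?_ fun _ _ => rfl
  ext T; simp

lemma finite_le (nu : YoungDiagram) : {σ : YoungDiagram | σ ≤ nu}.Finite := by
  have h : Set.InjOn YoungDiagram.cells
      (YoungDiagram.cells ⁻¹' (nu.cells.powerset : Set (Finset (ℕ × ℕ)))) := by
    intro σ _ τ _ h
    exact YoungDiagram.ext h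
  refine (Set.Finite.preimage h (Finset.finite_toSet _)).subset ?_
  intro σ hσ
  simpa using YoungDiagram.cells_subset_iff.2 hσ

/-- The possible shapes of the entries different from the largest one. -/
def brSet (lam : YoungDiagram) (n : ℕ) : Set YoungDiagram :=
  {mu | mu ≤ lam ∧ (∀ i j, (i + 1, j) ∈ lam → (i, j) ∈ mu) ∧ ∀ c ∈ mu, c.1 < n}

lemma brSet_finite (lam : YoungDiagram) (n : ℕ) : (brSet lam n).Finite :=
  (finite_le lam).subset fun _ h => h.1

lemma ssyt_mono {n : ℕ} {lam : YoungDiagram} {T : lam.cells → Fin n} (hT : IsSsyt lam.cells T)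
    (c c' : lam.cells) (h1 : c.1.1 ≤ c'.1.1) (h2 : c.1.2 ≤ c'.1.2) : T c ≤ T c' := by
  have hm : (c.1.1, c'.1.2) ∈ lam.cells :=
    YoungDiagram.mem_cells _ |>.2 (lam.up_left_mem h1 le_rfl ((YoungDiagram.mem_cells _).1 c'.2))
  refine (hT.1 c ⟨_, hm⟩ rfl h2).trans ?_
  rcases h1.eq_or_lt with h | h
  · exact hT.1 ⟨_, hm⟩ c' h le_rfl
  · exact (hT.2 ⟨_, hm⟩ c' h rfl).le

lemma ssyt_ge {n : ℕ} {lam : YoungDiagram} {T : lam.cells → Fin n} (hT : IsSsyt lam.cells T)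
    (i j : ℕ) (h : (i, j) ∈ lam.cells) : i ≤ (T ⟨(i, j), h⟩ : ℕ) := by
  induction i with
  | zero => exact Nat.zero_le _
  | succ i ih =>
    have hm : (i, j) ∈ lam.cells :=
      YoungDiagram.mem_cells _ |>.2
        (lam.up_left_mem (Nat.le_succ i) le_rfl ((YoungDiagram.mem_cells _).1 h))
    have h1 := ih hm
    have h2 : T ⟨(i, j), hm⟩ < T ⟨(i + 1, j), h⟩ := hT.2 _ _ (Nat.lt_succ_self i) rfl
    have h3 : (T ⟨(i, j), hm⟩ : ℕ) < T ⟨(i + 1, j), h⟩ := h2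
    omega

open Classical in
/-- The shape of the entries of `T` different from the largest one. -/
noncomputable def shp {n : ℕ} (lam : YoungDiagram) (T : lam.cells → Fin (n + 1)) :
    YoungDiagram :=
  if hT : IsSsyt lam.cells T then
    { cells := lam.cells.filter fun c => ∃ h : c ∈ lam.cells, T ⟨c, h⟩ ≠ Fin.last n
      isLowerSet := by
        intro c c' hcc hc
        simp only [Finset.coe_filter, Set.mem_ofPred_eq] at hc ⊢
        obtain ⟨h1, _, h2⟩ := hc
        have h3 : c' ∈ lam.cells := lam.isLowerSet hcc h1
        refine ⟨h3, h3, fun h => h2 ?_⟩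
        have := ssyt_mono hT ⟨c', h3⟩ ⟨c, h1⟩ hcc.1 hcc.2
        rw [h] at this
        exact le_antisymm (Fin.le_last _) this }
  else ⊥

lemma mem_shp {n : ℕ} {lam : YoungDiagram} {T : lam.cells → Fin (n + 1)}
    (hT : IsSsyt lam.cells T) (c : ℕ × ℕ) :
    c ∈ shp lam T ↔ ∃ h : c ∈ lam.cells, T ⟨c, h⟩ ≠ Fin.last n := by
  rw [shp, dif_pos hT]
  refine Finset.mem_filter.trans ?_
  exact ⟨fun h => h.2, fun h => ⟨h.1, h⟩⟩

lemma shp_mem {n : ℕ} {lam : YoungDiagram} {T : lam.cells → Fin (n + 1)}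
    (hT : IsSsyt lam.cells T) : shp lam T ∈ brSet lam n := by
  refine ⟨fun c hc => ?_, fun i j hij => ?_, fun c hc => ?_⟩
  · obtain ⟨h, _⟩ := (mem_shp hT c).1 hc
    exact (YoungDiagram.mem_cells c).1 h
  · have h0 : (i, j) ∈ lam.cells := (YoungDiagram.mem_cells _).2
      (lam.up_left_mem (Nat.le_succ i) le_rfl hij)
    refine (mem_shp hT _).2 ⟨h0, ?_⟩
    have h1 := hT.2 ⟨(i, j), h0⟩ ⟨(i + 1, j), (YoungDiagram.mem_cells _).2 hij⟩
      (Nat.lt_succ_self i) rfl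
    exact (h1.trans_le (Fin.le_last _)).ne
  · obtain ⟨h, h2⟩ := (mem_shp hT c).1 hc
    have h3 := ssyt_ge hT c.1 c.2 h
    by_contra hlt
    apply h2
    apply Fin.ext
    have h4 := (T ⟨c, h⟩).2
    have h5 : c.1 ≤ (T ⟨c, h⟩ : ℕ) := h3
    simp only [Fin.val_last]
    omega

open Classical in
/-- Extension of a filling by the largest entry. -/
noncomputable def extT {n : ℕ} (lam mu : YoungDiagram) (T : mu.cells → Fin n) :
    lam.cells → Fin (n + 1) :=
  fun c => if h : c.1 ∈ mu.cells then (T ⟨c.1, h⟩).castSucc else Fin.last n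

lemma extT_ssyt {n : ℕ} {lam mu : YoungDiagram} (hmu : mu ∈ brSet lam n) {T : mu.cells → Fin n}
    (hT : IsSsyt mu.cells T) : IsSsyt lam.cells (extT lam mu T) := by
  refine ⟨fun c c' h1 h2 => ?_, fun c c' h1 h2 => ?_⟩
  · by_cases h' : c'.1 ∈ mu.cells
    · have h : c.1 ∈ mu.cells := mu.isLowerSet (Prod.mk_le_mk.2 ⟨h1.le, h2⟩) h'
      simp only [extT, dif_pos h, dif_pos h', Fin.castSucc_le_castSucc_iff]
      exact hT.1 _ _ h1 h2
    · simp only [extT, dif_neg h']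
      exact Fin.le_last _
  · have h : c.1 ∈ mu.cells := by
      have h3 : (c.1.1 + 1, c.1.2) ∈ lam :=
        lam.up_left_mem (i2 := c'.1.1) (j2 := c'.1.2) h1 h2.le ((YoungDiagram.mem_cells _).1 c'.2)
      exact (YoungDiagram.mem_cells _).2 (hmu.2.1 _ _ h3)
    by_cases h' : c'.1 ∈ mu.cells
    · simp only [extT, dif_pos h, dif_pos h', Fin.castSucc_lt_castSucc_iff]
      exact hT.2 _ _ h1 h2
    · simp only [extT, dif_pos h, dif_neg h']
      exact Fin.castSucc_lt_last _

lemma shp_extT {n : ℕ} {lam mu : YoungDiagram} (hmu : mu ∈ brSet lam n) {T : mu.cells → Fin n}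
    (hT : IsSsyt mu.cells T) : shp lam (extT lam mu T) = mu := by
  apply SetLike.ext
  intro c
  rw [mem_shp (extT_ssyt hmu hT)]
  constructor
  · rintro ⟨h, h2⟩
    by_contra hc
    exact h2 (dif_neg hc)
  · intro hc
    have h : c ∈ lam.cells := (YoungDiagram.mem_cells _).2 (hmu.1 hc)
    refine ⟨h, ?_⟩
    have hc' : c ∈ mu.cells := hc
    simp only [extT, dif_pos hc']
    exact (Fin.castSucc_lt_last _).ne

open Classical in
lemma sgen_branch {A : Type} [CommRing A] (n : ℕ) (lam : YoungDiagram)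
    (x : Fin (n + 1) → A) (a : ℤ → A) :
    sgen (n + 1) lam.cells x a = ∑ mu ∈ (brSet_finite lam n).toFinset,
      sgen n mu.cells (fun i => x i.castSucc) a *
        ∏ c ∈ lam.cells \ mu.cells, (x (Fin.last n) - a ((n : ℤ) + 1 + (c.2 : ℤ) - (c.1 : ℤ))) := by
  rw [sgen_eq_sum, ← Finset.sum_fiberwise_of_maps_to (g := shp lam)
    (t := (brSet_finite lam n).toFinset)]
  swap
  · intro T hT
    simp only [Finset.mem_filter, Finset.mem_univ, true_and] at hT
    exact (Set.Finite.mem_toFinset _).2 (shp_mem hT)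
  refine Finset.sum_congr rfl fun mu hmu => ?_
  replace hmu : mu ∈ brSet lam n := (Set.Finite.mem_toFinset _).1 hmu
  rw [sgen_eq_sum, Finset.sum_mul]
  symm
  refine Finset.sum_bij (fun T _ => extT lam mu T) ?_ ?_ ?_ ?_
  · intro T hT
    simp only [Finset.mem_filter, Finset.mem_univ, true_and] at hT ⊢
    exact ⟨extT_ssyt hmu hT, shp_extT hmu hT⟩
  · intro T _ T' _ h
    ext c
    have hc : c.1 ∈ lam.cells := (YoungDiagram.mem_cells _).2 (hmu.1 c.2)
    have := congrFun h ⟨c.1, hc⟩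
    simp only [extT, dif_pos c.2] at this
    exact congrArg Fin.val (Fin.castSucc_injective _ this)
  · intro T hT
    simp only [Finset.mem_filter, Finset.mem_univ, true_and] at hT
    obtain ⟨hT, hs⟩ := hT
    have hsub : ∀ c : mu.cells, c.1 ∈ lam.cells := fun c =>
      (YoungDiagram.mem_cells _).2 (hmu.1 c.2)
    have hne : ∀ c : mu.cells, T ⟨c.1, hsub c⟩ ≠ Fin.last n := by
      intro c
      have : c.1 ∈ shp lam T := by rw [hs]; exact c.2
      exact ((mem_shp hT _).1 this).2
    refine ⟨fun c => (T ⟨c.1, hsub c⟩).castPred (hne c), ?_, ?_⟩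
    · simp only [Finset.mem_filter, Finset.mem_univ, true_and]
      refine ⟨fun c c' h1 h2 => ?_, fun c c' h1 h2 => ?_⟩
      · exact Fin.castPred_le_castPred_iff.2 (hT.1 ⟨c.1, hsub c⟩ ⟨c'.1, hsub c'⟩ h1 h2)
      · exact Fin.castPred_lt_castPred_iff.2 (hT.2 ⟨c.1, hsub c⟩ ⟨c'.1, hsub c'⟩ h1 h2)
    · funext c
      by_cases h : c.1 ∈ mu.cells
      · simp only [extT, dif_pos h, Fin.castSucc_castPred]
      · simp only [extT, dif_neg h]
        by_contra hc
        apply h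
        have : c.1 ∈ shp lam T := (mem_shp hT _).2 ⟨c.2, fun h' => hc h'.symm⟩
        rw [hs] at this
        exact this
  · intro T _
    let F : ℕ × ℕ → A := fun c => if h : c ∈ mu.cells then
      x (T ⟨c, h⟩).castSucc - a ((T ⟨c, h⟩ : ℤ) + 1 + (c.2 : ℤ) - (c.1 : ℤ))
      else x (Fin.last n) - a ((n : ℤ) + 1 + (c.2 : ℤ) - (c.1 : ℤ))
    have hsub : mu.cells ⊆ lam.cells := YoungDiagram.cells_subset_iff.2 hmu.1
    have e1 : ∏ c : mu.cells, (x (T c).castSucc -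
        a ((T c : ℤ) + 1 + ((c : ℕ × ℕ).2 : ℤ) - ((c : ℕ × ℕ).1 : ℤ))) = ∏ c ∈ mu.cells, F c := by
      rw [← Finset.prod_coe_sort mu.cells F]
      refine Finset.prod_congr rfl fun c _ => ?_
      simp only [F, dif_pos c.2]
    have e2 : ∏ c ∈ lam.cells \ mu.cells,
        (x (Fin.last n) - a ((n : ℤ) + 1 + (c.2 : ℤ) - (c.1 : ℤ))) =
        ∏ c ∈ lam.cells \ mu.cells, F c := by
      refine Finset.prod_congr rfl fun c hc => ?_
      simp only [F, dif_neg (Finset.mem_sdiff.1 hc).2]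
    rw [e1, e2, mul_comm, Finset.prod_sdiff hsub, ← Finset.prod_coe_sort lam.cells F]
    refine Finset.prod_congr rfl fun c _ => ?_
    by_cases h : c.1 ∈ mu.cells
    · simp only [F, extT, dif_pos h, Fin.val_castSucc]
    · simp only [F, extT, dif_neg h, Fin.val_last]

end Branch

section Bialternant

/-- The strictly decreasing exponent sequence of a partition. -/
def lv (n : ℕ) (lam : YoungDiagram) : Fin n → ℕ := fun i => lam.rowLen i + (n - 1 - i)

lemma rowLen_eq_of {mu : YoungDiagram} {i r : ℕ} (h : ∀ j, (i, j) ∈ mu ↔ j < r) :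
    mu.rowLen i = r := by
  have h1 := (h r).trans Iff.rfl
  have h2 := h (mu.rowLen i)
  rw [YoungDiagram.mem_iff_lt_rowLen] at h1 h2
  omega

lemma rowLen_zero {n : ℕ} {mu : YoungDiagram} (h : ∀ c ∈ mu, c.1 < n) (i : ℕ) (hi : n ≤ i) :
    mu.rowLen i = 0 := by
  by_contra h0
  have : (i, 0) ∈ mu := YoungDiagram.mem_iff_lt_rowLen.2 (Nat.pos_of_ne_zero h0)
  have := h _ this
  simp at this
  omega

lemma rowLen_le_of_le {mu nu : YoungDiagram} (h : mu ≤ nu) (i : ℕ) :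
    mu.rowLen i ≤ nu.rowLen i := by
  by_contra! hc
  have h1 : (i, nu.rowLen i) ∈ mu := YoungDiagram.mem_iff_lt_rowLen.2 hc
  have := YoungDiagram.mem_iff_lt_rowLen.1 (h h1)
  omega

lemma le_of_rowLen {mu nu : YoungDiagram} (h : ∀ i, mu.rowLen i ≤ nu.rowLen i) : mu ≤ nu := by
  rintro ⟨i, j⟩ hc
  have hc' := YoungDiagram.mem_iff_lt_rowLen.1 hc
  exact YoungDiagram.mem_iff_lt_rowLen.2 (hc'.trans_le (h i))

lemma lv_inj {n : ℕ} {mu nu : YoungDiagram} (hmu : ∀ c ∈ mu, c.1 < n) (hnu : ∀ c ∈ nu, c.1 < n)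
    (h : lv n mu = lv n nu) : mu = nu := by
  have key : ∀ i, mu.rowLen i = nu.rowLen i := by
    intro i
    by_cases hi : i < n
    · have := congrFun h ⟨i, hi⟩
      simp only [lv] at this
      omega
    · rw [rowLen_zero hmu i (by omega), rowLen_zero hnu i (by omega)]
  exact le_antisymm (le_of_rowLen fun i => (key i).le) (le_of_rowLen fun i => (key i).ge)

lemma prod_skew {K : Type} [Field K] {n : ℕ} {lam mu : YoungDiagram} (a : ℤ → K)
    (hlam : ∀ c ∈ lam, c.1 < n + 1) (hmu : mu ∈ brSet lam n) (y : K) :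
    ∏ c ∈ lam.cells \ mu.cells, (y - a ((n : ℤ) + 1 + (c.2 : ℤ) - (c.1 : ℤ))) =
      (∏ i : Fin n, ∏ k ∈ Finset.Ico (lv n mu i + 1) (lv (n + 1) lam i.castSucc),
        (y - a ((k : ℤ) + 1))) *
      fp (fun k => a ((k : ℤ) + 1)) (lv (n + 1) lam (Fin.last n)) y := by
  rw [Finset.prod_finset_product (lam.cells \ mu.cells) (Finset.range (n + 1))
    (fun i => Finset.Ico (mu.rowLen i) (lam.rowLen i)), Finset.prod_range, Fin.prod_univ_castSucc]
  · congr 1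
    · refine Finset.prod_congr rfl fun i _ => ?_
      have hi := i.2
      have e1 : lv n mu i + 1 = mu.rowLen i + (n - i) := by simp only [lv]; omega
      have e2 : lv (n + 1) lam i.castSucc = lam.rowLen i + (n - i) := by
        simp only [lv, Fin.val_castSucc]; omega
      rw [e1, e2, ← Finset.prod_Ico_add']
      refine Finset.prod_congr rfl fun j _ => ?_
      congr 2
      simp only [Fin.val_castSucc]
      omega
    · rw [fp, Fin.val_last, rowLen_zero hmu.2.2 n le_rfl, Finset.range_eq_Ico]
      have e2 : lv (n + 1) lam (Fin.last n) = lam.rowLen n := by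
        simp [lv]
      rw [e2]
      refine Finset.prod_congr rfl fun j _ => ?_
      congr 2
      simp
      ring
  · rintro ⟨i, j⟩
    simp only [Finset.mem_sdiff, YoungDiagram.mem_cells, YoungDiagram.mem_iff_lt_rowLen,
      Finset.mem_range, Finset.mem_Ico, not_lt]
    constructor
    · rintro ⟨h1, h2⟩
      exact ⟨hlam (i, j) (YoungDiagram.mem_iff_lt_rowLen.2 h1), h2, h1⟩
    · rintro ⟨_, h2, h3⟩
      exact ⟨h3, h2⟩

lemma exists_of_interlace {n : ℕ} {lam : YoungDiagram} (hlam : ∀ c ∈ lam, c.1 < n + 1)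
    (m : Fin n → ℕ)
    (hm : ∀ i : Fin n, lv (n + 1) lam i.succ ≤ m i ∧ m i < lv (n + 1) lam i.castSucc) :
    ∃ mu ∈ brSet lam n, lv n mu = m := by
  classical
  have hm1 : ∀ (i : ℕ) (hi : i < n), lam.rowLen (i + 1) + (n - 1 - i) ≤ m ⟨i, hi⟩ := by
    intro i hi
    have := (hm ⟨i, hi⟩).1
    simp only [lv, Fin.val_succ] at this
    omega
  have hm2 : ∀ (i : ℕ) (hi : i < n), m ⟨i, hi⟩ < lam.rowLen i + (n - i) := by
    intro i hi
    have := (hm ⟨i, hi⟩).2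
    simp only [lv, Fin.val_castSucc] at this
    omega
  let S : Finset (ℕ × ℕ) := lam.cells.filter fun c => ∃ h : c.1 < n, c.2 + (n - 1 - c.1) < m ⟨c.1, h⟩
  have hS : IsLowerSet (S : Set (ℕ × ℕ)) := by
    rintro ⟨i, j⟩ ⟨i', j'⟩ hle hc
    obtain ⟨hle1, hle2⟩ := Prod.mk_le_mk.1 hle
    have hc' := Finset.mem_filter.1 (Finset.mem_coe.1 hc)
    obtain ⟨h1, h2, h3⟩ := hc'
    refine Finset.mem_coe.2 (Finset.mem_filter.2 ⟨lam.isLowerSet hle h1, ?_⟩)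
    simp only at h2 h3
    refine ⟨by simp only; omega, ?_⟩
    simp only
    rcases hle1.eq_or_lt with h | h
    · subst h; omega
    · have h4 := YoungDiagram.mem_iff_lt_rowLen.1 ((YoungDiagram.mem_cells _).1 h1)
      have h5 := lam.rowLen_anti (i' + 1) i h
      have h6 := hm1 i' (by omega)
      omega
  let mu : YoungDiagram := ⟨S, hS⟩
  have hmem : ∀ i j, (i, j) ∈ mu ↔ j < lam.rowLen i ∧ ∃ h : i < n, j + (n - 1 - i) < m ⟨i, h⟩ := by
    intro i j
    refine Finset.mem_filter.trans ?_
    rw [YoungDiagram.mem_cells, YoungDiagram.mem_iff_lt_rowLen]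
  refine ⟨mu, ⟨?_, ?_, ?_⟩, ?_⟩
  · rintro ⟨i, j⟩ hc
    exact YoungDiagram.mem_iff_lt_rowLen.2 ((hmem i j).1 hc).1
  · intro i j hij
    have h1 := hlam _ hij
    simp only at h1
    have h2 := YoungDiagram.mem_iff_lt_rowLen.1 hij
    have h3 := lam.rowLen_anti i (i + 1) (Nat.le_succ i)
    have h4 := hm1 i (by omega)
    exact (hmem i j).2 ⟨by omega, by omega, by omega⟩
  · rintro ⟨i, j⟩ hc
    exact ((hmem i j).1 hc).2.1
  · funext i
    obtain ⟨i, hi⟩ := i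
    have h1 := hm1 i hi
    have h2 := hm2 i hi
    have : mu.rowLen i = m ⟨i, hi⟩ - (n - 1 - i) := by
      apply rowLen_eq_of
      intro j
      rw [hmem]
      constructor
      · rintro ⟨_, _, h⟩; omega
      · intro h; exact ⟨by omega, hi, by omega⟩
    simp only [lv, this]
    omega

theorem sgen_det {K : Type} [Field K] (a : ℤ → K) : ∀ (n : ℕ) (lam : YoungDiagram)
    (_ : ∀ c ∈ lam, c.1 < n) (x : Fin n → K),
    vd n x * sgen n lam.cells x a = (altM (fun k => a ((k : ℤ) + 1)) (lv n lam) x).det := by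
  intro n
  induction n with
  | zero =>
    intro lam hlam x
    have h0 : lam.cells = ∅ := by
      apply Finset.eq_empty_of_forall_notMem
      intro c hc
      exact absurd (hlam c hc) (by omega)
    classical
    have : IsEmpty lam.cells := by rw [h0]; infer_instance
    rw [sgen_eq_sum]
    have hall : ∀ T : lam.cells → Fin 0, IsSsyt lam.cells T := fun T =>
      ⟨fun c => isEmptyElim c, fun c => isEmptyElim c⟩
    simp [vd, hall]
  | succ n ih =>
    intro lam hlam x
    rw [det_branch, sgen_branch, vd]
    · rw [mul_comm (vd n _), mul_assoc]
      congr 1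
      rw [Finset.mul_sum]
      refine Finset.sum_bij (fun mu _ => lv n mu) ?_ ?_ ?_ ?_
      · intro mu hmu
        replace hmu : mu ∈ brSet lam n := (Set.Finite.mem_toFinset _).1 hmu
        rw [Fintype.mem_piFinset]
        intro i
        have hi := i.2
        rw [Finset.mem_Ico]
        simp only [lv, Fin.val_succ, Fin.val_castSucc]
        have h1 := rowLen_le_of_le hmu.1 i
        have h2 : lam.rowLen (i + 1) ≤ mu.rowLen i := by
          by_contra! hc
          have h3 := hmu.2.1 _ _ (YoungDiagram.mem_iff_lt_rowLen.2 hc)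
          have h4 := YoungDiagram.mem_iff_lt_rowLen.1 h3
          omega
        omega
      · intro mu hmu mu' hmu' h
        replace hmu : mu ∈ brSet lam n := (Set.Finite.mem_toFinset _).1 hmu
        replace hmu' : mu' ∈ brSet lam n := (Set.Finite.mem_toFinset _).1 hmu'
        exact lv_inj hmu.2.2 hmu'.2.2 h
      · intro m hm
        rw [Fintype.mem_piFinset] at hm
        obtain ⟨mu, h1, h2⟩ := exists_of_interlace hlam m fun i => Finset.mem_Ico.1 (hm i)
        exact ⟨mu, (Set.Finite.mem_toFinset _).2 h1, h2⟩
      · intro mu hmu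
        replace hmu : mu ∈ brSet lam n := (Set.Finite.mem_toFinset _).1 hmu
        rw [← mul_assoc, ih mu hmu.2.2, prod_skew a hlam hmu]
    · intro i
      have hi := i.2
      simp only [lv, Fin.val_succ, Fin.val_castSucc]
      have := lam.rowLen_anti i (i + 1) (Nat.le_succ _)
      omega

end Bialternant

section Pieri

lemma alt_vanish {K : Type} [Field K] {n : ℕ} (b : ℕ → K) {sig nu : YoungDiagram}
    (hsig : ∀ c ∈ sig, c.1 < n) (h : ¬ sig ≤ nu) :
    (altM b (lv n sig) (fun j => b (lv n nu j))).det = 0 := by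
  have : ∃ i, nu.rowLen i < sig.rowLen i := by
    by_contra! hc
    exact h (le_of_rowLen hc)
  obtain ⟨i, hi⟩ := this
  have hin : i < n := by
    by_contra hc
    rw [rowLen_zero hsig i (by omega)] at hi
    omega
  refine det_vanish _ ⟨i, hin⟩ fun i' j h1 h2 => ?_
  have h1' : (i' : ℕ) ≤ i := h1
  have h2' : i ≤ (j : ℕ) := h2
  have h3 := sig.rowLen_anti i' i h1'
  have h4 := nu.rowLen_anti i j h2'
  change fp b (lv n sig i') (b (lv n nu j)) = 0
  rw [fp]
  refine Finset.prod_eq_zero (i := lv n nu j) ?_ (sub_self _)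
  rw [Finset.mem_range]
  simp only [lv]
  omega

lemma cover_row {n : ℕ} {mu sig : YoungDiagram} (h : Covers mu sig) (hsig : ∀ c ∈ sig, c.1 < n) :
    ∃ i : Fin n, lv n sig = Function.update (lv n mu) i (lv n mu i + 1) := by
  classical
  obtain ⟨hle, hcard⟩ := h
  have hsub : mu.cells ⊆ sig.cells := YoungDiagram.cells_subset_iff.2 hle
  have h1 : (sig.cells \ mu.cells).card = 1 := by
    rw [Finset.card_sdiff_of_subset hsub]
    change sig.cells.card = mu.cells.card + 1 at hcard
    omega
  obtain ⟨c, hc⟩ := Finset.card_eq_one.1 h1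
  have hmem : ∀ i j, (i, j) ∈ sig ↔ (i, j) ∈ mu ∨ (i, j) = c := by
    intro i j
    have h2 : (i, j) ∈ sig.cells \ mu.cells ↔ (i, j) = c := by rw [hc, Finset.mem_singleton]
    rw [Finset.mem_sdiff, YoungDiagram.mem_cells, YoungDiagram.mem_cells] at h2
    have h3 : (i, j) ∈ mu → (i, j) ∈ sig := fun h => hle h
    tauto
  obtain ⟨p, q⟩ := c
  have hpq : (p, q) ∈ sig.cells \ mu.cells := by rw [hc]; simp
  rw [Finset.mem_sdiff, YoungDiagram.mem_cells, YoungDiagram.mem_cells] at hpq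
  have hp : p < n := hsig _ hpq.1
  have hq1 := YoungDiagram.mem_iff_lt_rowLen.1 hpq.1
  have hq2 : mu.rowLen p ≤ q := by
    by_contra! hlt
    exact hpq.2 (YoungDiagram.mem_iff_lt_rowLen.2 hlt)
  have hqe : mu.rowLen p = q := by
    rcases hq2.eq_or_lt with h | h
    · exact h
    · have h2 : (p, mu.rowLen p) ∈ sig := YoungDiagram.mem_iff_lt_rowLen.2 (by omega)
      rcases (hmem _ _).1 h2 with h3 | h3
      · have := YoungDiagram.mem_iff_lt_rowLen.1 h3
        omega
      · exact (Prod.mk.inj h3).2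
  have hrow : ∀ i, sig.rowLen i = if i = p then mu.rowLen i + 1 else mu.rowLen i := by
    intro i
    apply rowLen_eq_of
    intro j
    rw [hmem, YoungDiagram.mem_iff_lt_rowLen, Prod.mk.injEq]
    split_ifs with hi
    · subst hi; omega
    · simp [hi]
  refine ⟨⟨p, hp⟩, ?_⟩
  funext i
  by_cases hi : i = ⟨p, hp⟩
  · subst hi
    simp only [Function.update_self, lv, hrow, if_true]
    omega
  · have hi' : (i : ℕ) ≠ p := fun h => hi (Fin.ext h)
    rw [Function.update_of_ne hi]
    simp only [lv, hrow, if_neg hi']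

lemma cover_build {n : ℕ} {mu : YoungDiagram} (hmu : ∀ c ∈ mu, c.1 < n) (i : Fin n)
    (h : ∀ k < (i : ℕ), mu.rowLen i < mu.rowLen k) :
    ∃ sig, Covers mu sig ∧ (∀ c ∈ sig, c.1 < n) ∧
      lv n sig = Function.update (lv n mu) i (lv n mu i + 1) := by
  classical
  have hnot : ((i : ℕ), mu.rowLen i) ∉ mu.cells := by
    rw [YoungDiagram.mem_cells, YoungDiagram.mem_iff_lt_rowLen]; omega
  let S : Finset (ℕ × ℕ) := insert ((i : ℕ), mu.rowLen i) mu.cells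
  have hS : IsLowerSet (S : Set (ℕ × ℕ)) := by
    rintro ⟨p, q⟩ ⟨p', q'⟩ hle hc
    have hc' := Finset.mem_insert.1 (Finset.mem_coe.1 hc)
    refine Finset.mem_coe.2 (Finset.mem_insert.2 ?_)
    rcases hc' with hc' | hc'
    · obtain ⟨h1, h2⟩ := Prod.mk_le_mk.1 hle
      obtain ⟨rfl, rfl⟩ := Prod.mk.inj hc'
      rw [YoungDiagram.mem_cells, YoungDiagram.mem_iff_lt_rowLen, Prod.mk.injEq]
      rcases h1.eq_or_lt with h3 | h3
      · subst h3; omega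
      · have := h _ h3
        omega
    · exact Or.inr (mu.isLowerSet hle hc')
  let sig : YoungDiagram := ⟨S, hS⟩
  have hcov : Covers mu sig := by
    refine ⟨YoungDiagram.cells_subset_iff.1 (Finset.subset_insert _ _), ?_⟩
    exact Finset.card_insert_of_notMem hnot
  have hmem : ∀ c, c ∈ sig ↔ c = ((i : ℕ), mu.rowLen i) ∨ c ∈ mu.cells := fun c =>
    Finset.mem_insert
  refine ⟨sig, hcov, ?_, ?_⟩
  · intro c hc
    rcases (hmem c).1 hc with h1 | h1
    · rw [h1]; exact i.2
    · exact hmu c h1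
  · have hrow : ∀ k, sig.rowLen k = if k = i then mu.rowLen k + 1 else mu.rowLen k := by
      intro k
      apply rowLen_eq_of
      intro j
      rw [hmem, YoungDiagram.mem_cells, YoungDiagram.mem_iff_lt_rowLen, Prod.mk.injEq]
      split_ifs with hi
      · subst hi; omega
      · simp [hi]
    funext k
    by_cases hk : k = i
    · subst hk
      simp only [Function.update_self, lv, hrow, if_true]
      omega
    · have hk' : (k : ℕ) ≠ i := fun h => hk (Fin.ext h)
      rw [Function.update_of_ne hk]
      simp only [lv, hrow, if_neg hk']

/-- The covers of `mu` below `nu`. -/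
def covSet (mu nu : YoungDiagram) : Set YoungDiagram := {sig | Covers mu sig ∧ sig ≤ nu}

lemma covSet_finite (mu nu : YoungDiagram) : (covSet mu nu).Finite :=
  (finite_le nu).subset fun _ h => h.2

lemma rows_of_le {n : ℕ} {mu nu : YoungDiagram} (h : mu ≤ nu) (hnu : ∀ c ∈ nu, c.1 < n) :
    ∀ c ∈ mu, c.1 < n := fun c hc => hnu c (h hc)

lemma det_sum_covers {K : Type} [Field K] {n : ℕ} (b : ℕ → K) {mu nu : YoungDiagram}
    (hsub : mu ≤ nu) (hnu : ∀ c ∈ nu, c.1 < n) :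
    ∑ sig ∈ (covSet_finite mu nu).toFinset,
        (altM b (lv n sig) (fun j => b (lv n nu j))).det =
      ∑ i, (altM b (Function.update (lv n mu) i (lv n mu i + 1)) (fun j => b (lv n nu j))).det := by
  have hmu := rows_of_le hsub hnu
  have hex : ∀ sig ∈ (covSet_finite mu nu).toFinset,
      ∃ i : Fin n, lv n sig = Function.update (lv n mu) i (lv n mu i + 1) := by
    intro sig hs
    have hs' : sig ∈ covSet mu nu := (Set.Finite.mem_toFinset _).1 hs
    exact cover_row hs'.1 (rows_of_le hs'.2 hnu)
  choose e he using hex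
  refine Finset.sum_bij_ne_zero (fun sig h _ => e sig h) ?_ ?_ ?_ ?_
  · intros; exact Finset.mem_univ _
  · intro s1 h1 _ s2 h2 _ h
    have h1' : s1 ∈ covSet mu nu := (Set.Finite.mem_toFinset _).1 h1
    have h2' : s2 ∈ covSet mu nu := (Set.Finite.mem_toFinset _).1 h2
    refine lv_inj (rows_of_le h1'.2 hnu) (rows_of_le h2'.2 hnu) ?_
    rw [he s1 h1, he s2 h2, h]
  · intro i _ hne
    have hcond : ∀ k < (i : ℕ), mu.rowLen i < mu.rowLen k := by
      intro k hk
      by_contra! hc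
      apply hne
      have hi := i.2
      let i' : Fin n := ⟨i - 1, by omega⟩
      have hne' : i' ≠ i := fun h => by
        have := congrArg Fin.val h
        simp only [i'] at this
        omega
      refine Matrix.det_zero_of_row_eq hne' ?_
      have e1 : mu.rowLen (i' : ℕ) = mu.rowLen i := by
        have h1 := mu.rowLen_anti k i' (by simp only [i']; omega)
        have h2 := mu.rowLen_anti i' i (by simp only [i']; omega)
        omega
      have e2 : Function.update (lv n mu) i (lv n mu i + 1) i' =
          Function.update (lv n mu) i (lv n mu i + 1) i := by
        rw [Function.update_of_ne hne', Function.update_self]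
        simp only [lv, e1]
        simp only [i']
        omega
      funext j
      simp only [altM, Matrix.of_apply, e2]
    obtain ⟨sig, hcov, hrows, hlv⟩ := cover_build hmu i hcond
    have hle : sig ≤ nu := by
      by_contra hc
      apply hne
      rw [← hlv]
      exact alt_vanish b hrows hc
    have hs : sig ∈ (covSet_finite mu nu).toFinset :=
      (Set.Finite.mem_toFinset _).2 ⟨hcov, hle⟩
    refine ⟨sig, hs, by rw [hlv]; exact hne, ?_⟩
    have h1 := (he sig hs).symm.trans hlv
    by_contra hc
    have h2 := congrFun h1 i
    rw [Function.update_self, Function.update_of_ne (fun h => hc h.symm)] at h2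
    omega
  · intro sig hs _
    rw [he sig hs]

lemma subA_eq {K : Type} [Field K] (n : ℕ) (a : ℤ → K) (nu : YoungDiagram) :
    subA n a nu = fun j => (fun k : ℕ => a ((k : ℤ) + 1)) (lv n nu j) := by
  funext j
  have := j.2
  simp only [subA, lv]
  congr 1
  omega

lemma lv_injective (n : ℕ) (nu : YoungDiagram) : Function.Injective (lv n nu) := by
  have key : ∀ i j : Fin n, i < j → lv n nu i ≠ lv n nu j := by
    intro i j h
    have h' : (i : ℕ) < j := h
    have := nu.rowLen_anti i j h'.le
    have := j.2
    simp only [lv]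
    omega
  intro i j h
  rcases lt_trichotomy i j with h1 | h1 | h1
  · exact absurd h (key _ _ h1)
  · exact h1
  · exact absurd h.symm (key _ _ h1)

lemma sgen_pieri {K : Type} [Field K] (n : ℕ) (a : ℤ → K) (ha : Function.Injective a)
    {mu nu : YoungDiagram} (hsub : mu ≤ nu) (hnu : ∀ c ∈ nu, c.1 < n) :
    (aNorm n a nu - aNorm n a mu) * sgen n mu.cells (subA n a nu) a =
      ∑ sig ∈ (covSet_finite mu nu).toFinset, sgen n sig.cells (subA n a nu) a := by
  have hx : Function.Injective (subA n a nu) := by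
    rw [subA_eq]
    intro i j h
    apply lv_injective n nu
    have := ha h
    omega
  have hv := vd_ne_zero n _ hx
  apply mul_left_cancel₀ hv
  rw [mul_left_comm, sgen_det a n mu (rows_of_le hsub hnu), Finset.mul_sum]
  have h1 : ∑ sig ∈ (covSet_finite mu nu).toFinset,
      vd n (subA n a nu) * sgen n sig.cells (subA n a nu) a =
      ∑ sig ∈ (covSet_finite mu nu).toFinset,
        (altM (fun k : ℕ => a ((k : ℤ) + 1)) (lv n sig) (subA n a nu)).det := by
    refine Finset.sum_congr rfl fun sig hs => ?_
    have hs' : sig ∈ covSet mu nu := (Set.Finite.mem_toFinset _).1 hs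
    exact sgen_det a n sig (rows_of_le hs'.2 hnu) _
  rw [h1]
  simp only [aNorm]
  rw [subA_eq n a nu, subA_eq n a mu, det_sum_covers _ hsub hnu, det_pieri]

end Pieri

section Chains

lemma chain_le {mu nu : YoungDiagram} {L : List YoungDiagram} (h : L ∈ chainSet mu nu) :
    mu ≤ nu := by
  induction L generalizing mu with
  | nil => simp [chainSet] at h
  | cons s L ih =>
    obtain ⟨h1, h2, h3⟩ := h
    simp only [List.head?_cons, Option.some.injEq] at h2
    subst h2
    cases L with
    | nil =>
      simp only [List.getLast?_singleton, Option.some.injEq] at h3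
      exact h3.le
    | cons t L =>
      have h1' := List.isChain_cons_cons.1 h1
      refine h1'.1.1.trans (ih ⟨h1'.2, rfl, ?_⟩)
      rw [← h3, List.getLast?_cons_cons]

lemma chainSet_self (mu : YoungDiagram) : chainSet mu mu = {[mu]} := by
  ext L
  constructor
  · intro h
    rcases L with _ | ⟨s, _ | ⟨t, L⟩⟩
    · simp [chainSet] at h
    · obtain ⟨_, h2, _⟩ := h
      simp only [List.head?_cons, Option.some.injEq] at h2
      rw [h2]; rfl
    · exfalso
      obtain ⟨h1, h2, h3⟩ := h
      simp only [List.head?_cons, Option.some.injEq] at h2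
      subst h2
      have h1' := List.isChain_cons_cons.1 h1
      have hle : t ≤ s := chain_le (L := t :: L)
        ⟨h1'.2, rfl, by rw [← h3, List.getLast?_cons_cons]⟩
      have := Finset.card_le_card (YoungDiagram.cells_subset_iff.2 hle)
      have h4 : t.cells.card = s.cells.card + 1 := h1'.1.2
      omega
  · rintro rfl
    exact ⟨List.isChain_singleton _, rfl, rfl⟩

lemma chainSet_step {mu nu : YoungDiagram} (h : mu ≠ nu) :
    chainSet mu nu = ⋃ sig ∈ covSet mu nu, (List.cons mu) '' chainSet sig nu := by
  ext L
  simp only [Set.mem_iUnion, Set.mem_image, exists_prop]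
  constructor
  · intro hL
    rcases L with _ | ⟨s, _ | ⟨t, L⟩⟩
    · simp [chainSet] at hL
    · obtain ⟨_, h2, h3⟩ := hL
      simp only [List.head?_cons, List.getLast?_singleton, Option.some.injEq] at h2 h3
      exact absurd (h2.symm.trans h3) h
    · obtain ⟨h1, h2, h3⟩ := hL
      simp only [List.head?_cons, Option.some.injEq] at h2
      subst h2
      have h1' := List.isChain_cons_cons.1 h1
      have hc : t :: L ∈ chainSet t nu :=
        ⟨h1'.2, rfl, by rw [← h3, List.getLast?_cons_cons]⟩
      exact ⟨t, ⟨h1'.1, chain_le hc⟩, t :: L, hc, rfl⟩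
  · rintro ⟨sig, hs, L', hL', rfl⟩
    rcases L' with _ | ⟨t, L'⟩
    · simp [chainSet] at hL'
    · obtain ⟨h1, h2, h3⟩ := hL'
      simp only [List.head?_cons, Option.some.injEq] at h2
      subst h2
      exact ⟨List.isChain_cons_cons.2 ⟨hs.1, h1⟩, rfl, by rw [List.getLast?_cons_cons, h3]⟩

lemma chainSet_finite (nu : YoungDiagram) : ∀ (d : ℕ) (mu : YoungDiagram),
    nu.card - mu.card = d → (chainSet mu nu).Finite := by
  intro d
  induction d using Nat.strong_induction_on with
  | _ d ih =>
    intro mu hd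
    by_cases h : mu = nu
    · subst h; rw [chainSet_self]; exact Set.finite_singleton _
    · rw [chainSet_step h]
      refine (covSet_finite mu nu).biUnion fun sig hs => Set.Finite.image _ ?_
      have h1 : sig.card = mu.card + 1 := hs.1.2
      have h2 : sig.card ≤ nu.card := Finset.card_le_card (YoungDiagram.cells_subset_iff.2 hs.2)
      exact ih (nu.card - sig.card) (by omega) sig rfl

lemma H_self {K : Type} [Field K] (n : ℕ) (a : ℤ → K) (mu : YoungDiagram) : H n a mu mu = 1 := by
  rw [H, chainSet_self, finsum_mem_singleton]
  simp

lemma H_step {K : Type} [Field K] (n : ℕ) (a : ℤ → K) {mu nu : YoungDiagram} (h : mu ≠ nu) :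
    H n a mu nu = (aNorm n a nu - aNorm n a mu)⁻¹ *
      ∑ sig ∈ (covSet_finite mu nu).toFinset, H n a sig nu := by
  rw [H, chainSet_step h, finsum_mem_biUnion _ (covSet_finite mu nu)
    (fun sig _ => (chainSet_finite nu _ sig rfl).image _),
    finsum_mem_eq_finite_toFinset_sum _ (covSet_finite mu nu), Finset.mul_sum]
  · refine Finset.sum_congr rfl fun sig _ => ?_
    rw [finsum_mem_image (List.cons_injective.injOn), H,
      finsum_mem_eq_finite_toFinset_sum _ (chainSet_finite nu _ sig rfl),
      finsum_mem_eq_finite_toFinset_sum _ (chainSet_finite nu _ sig rfl), Finset.mul_sum]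
    refine Finset.sum_congr rfl fun L hL => ?_
    replace hL : L ∈ chainSet sig nu := (Set.Finite.mem_toFinset _).1 hL
    rcases L with _ | ⟨t, L⟩
    · simp [chainSet] at hL
    · rw [List.dropLast_cons_cons, List.map_cons, List.prod_cons]
  · intro s1 _ s2 _ hne
    refine Set.disjoint_left.2 ?_
    rintro _ ⟨L1, h1, rfl⟩ ⟨L2, h2, he⟩
    have he' : L2 = L1 := (List.cons.inj he).2
    subst he'
    apply hne
    have := h1.2.1.symm.trans h2.2.1
    exact Option.some.inj this

end Chains

lemma aK_injective : Function.Injective aK := by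
  intro i j h
  have h1 := IsFractionRing.injective (MvPolynomial ℤ ℚ) Kfield h
  exact MvPolynomial.X_injective h1

lemma aNorm_ne {n : ℕ} {mu nu : YoungDiagram} (hsub : mu ≤ nu) (hne : mu ≠ nu)
    (hnu : ∀ c ∈ nu, c.1 < n) : aNorm n aK nu - aNorm n aK mu ≠ 0 := by
  intro h
  have h1 := sub_eq_zero.1 h
  have key : ∀ ρ : YoungDiagram, aNorm n aK ρ = algebraMap (MvPolynomial ℤ ℚ) Kfield
      (∑ i : Fin n, MvPolynomial.X ((ρ.rowLen i : ℤ) + (n : ℤ) - (i : ℤ))) := by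
    intro ρ
    rw [map_sum]
    rfl
  rw [key, key] at h1
  have h2 := IsFractionRing.injective (MvPolynomial ℤ ℚ) Kfield h1
  have h3 := congrArg (MvPolynomial.eval (fun k : ℤ => (k : ℚ))) h2
  simp only [map_sum, MvPolynomial.eval_X] at h3
  have hex : ∃ i, mu.rowLen i < nu.rowLen i := by
    by_contra! hc
    exact hne (le_antisymm hsub (le_of_rowLen hc))
  obtain ⟨i, hi⟩ := hex
  have hin : i < n := by
    by_contra hc
    rw [rowLen_zero hnu i (by omega)] at hi
    omega
  refine absurd h3 (ne_of_gt ?_)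
  refine Finset.sum_lt_sum (fun k _ => ?_) ⟨⟨i, hin⟩, Finset.mem_univ _, ?_⟩
  · have := rowLen_le_of_le hsub k
    exact_mod_cast (by omega : (mu.rowLen k : ℤ) + n - k ≤ (nu.rowLen k : ℤ) + n - k)
  · exact_mod_cast (by omega : (mu.rowLen i : ℤ) + n - i < (nu.rowLen i : ℤ) + n - i)

lemma ratio_aux (n : ℕ) (nu : YoungDiagram) (hnu : ∀ c ∈ nu, c.1 < n) : ∀ (d : ℕ)
    (mu : YoungDiagram), nu.card - mu.card = d → mu ≤ nu →
    sgen n mu.cells (subA n aK nu) aK =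
      sgen n nu.cells (subA n aK nu) aK * H n aK mu nu := by
  intro d
  induction d using Nat.strong_induction_on with
  | _ d ih =>
    intro mu hd hsub
    by_cases h : mu = nu
    · subst h; rw [H_self, mul_one]
    · have hD := aNorm_ne hsub h hnu
      apply mul_left_cancel₀ hD
      rw [sgen_pieri n aK aK_injective hsub hnu, H_step n aK h, mul_left_comm, ← mul_assoc (_ - _),
        mul_inv_cancel₀ hD, one_mul, Finset.mul_sum]
      refine Finset.sum_congr rfl fun sig hs => ?_
      replace hs : sig ∈ covSet mu nu := (Set.Finite.mem_toFinset _).1 hs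
      have h1 : sig.card = mu.card + 1 := hs.1.2
      have h2 : sig.card ≤ nu.card := Finset.card_le_card (YoungDiagram.cells_subset_iff.2 hs.2)
      exact ih (nu.card - sig.card) (by omega) sig rfl hs.2

/-- For `μ ⊆ ν`, `s_μ(a_ν|a) = s_ν(a_ν|a)·H(μ,ν)` in `ℚ(a_i : i ∈ ℤ)`, i.e.
`s_μ(a_ν|a)/s_ν(a_ν|a)` is the sum over all chains `μ = ρ⁽⁰⁾ → ⋯ → ρ⁽ˡ⁾ = ν` of
`∏_{i=0}^{l-1} 1/(|a_ν| − |a_{ρ⁽ⁱ⁾}|)`. -/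
theorem ratio_eq_H (n : ℕ) (hn : 1 ≤ n) (mu nu : YoungDiagram)
    (hmu : mu.colLen 0 ≤ n) (hnu : nu.colLen 0 ≤ n) (hsub : mu ≤ nu) :
    sgen n mu.cells (subA n aK nu) aK =
      sgen n nu.cells (subA n aK nu) aK * H n aK mu nu := by
  have hnu' : ∀ c ∈ nu, c.1 < n := by
    rintro ⟨i, j⟩ hc
    have h1 : (i, 0) ∈ nu := nu.up_left_mem le_rfl (Nat.zero_le j) hc
    exact (YoungDiagram.mem_iff_lt_colLen.1 h1).trans_le hnu
  exact ratio_aux n nu hnu' _ mu rfl hsub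

end FactorialLR
end
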